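/- arXiv:1702.08102 — 10 statements merged into one kernel-verified Lean document; each statement's English description precedes it below -/
import Mathlib

section
/- (Swart) Let K be a field and let W : ℤ → K be a normalized non-degenerate elliptic sequence. Let E be the Weierstrass curve over K with coefficients a₁ = (W(4) + W(2)⁵ − 2·W(2)·W(3))/(W(2)²·W(3)), a₂ = (W(2)·W(3)² + W(4) + W(2)⁵ − W(2)·W(3))/(W(2)³·W(3)), a₃ = W(2), a₄ = 1, a₆ = 0. Then the point (0,0) lies on E, and for every n ∈ ℤ, W(n) equals the n-th division polynomial ψₙ of E evaluated at the point (x,y) = (0,0). -/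
open Polynomial

/-- **Swart's theorem.** Let `W : ℤ → K` be a normalized non-degenerate elliptic sequence
over a field `K`. Let `E` be the Weierstrass curve with coefficients
`a₁ = (W 4 + W 2 ^ 5 − 2 W 2 W 3)/(W 2 ^ 2 W 3)`,
`a₂ = (W 2 W 3 ^ 2 + W 4 + W 2 ^ 5 − W 2 W 3)/(W 2 ^ 3 W 3)`,
`a₃ = W 2`, `a₄ = 1`, `a₆ = 0`. Then `(0, 0)` lies on `E` and `W n` equals the `n`-th
division polynomial `Ψₙ` of `E` evaluated at `(0, 0)`. -/
theorem swart_elliptic_sequence {K : Type*} [Field K] (W : ℤ → K)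
    (hrec : ∀ m n : ℤ,
      W (m + n) * W (m - n) =
        W (m + 1) * W (m - 1) * W n ^ 2 - W (n + 1) * W (n - 1) * W m ^ 2)
    (hnd : W 1 * W 2 * W 3 ≠ 0) (hnorm : W 1 = 1)
    (E : WeierstrassCurve K)
    (ha1 : E.a₁ = (W 4 + W 2 ^ 5 - 2 * W 2 * W 3) / (W 2 ^ 2 * W 3))
    (ha2 : E.a₂ = (W 2 * W 3 ^ 2 + W 4 + W 2 ^ 5 - W 2 * W 3) / (W 2 ^ 3 * W 3))
    (ha3 : E.a₃ = W 2) (ha4 : E.a₄ = 1) (ha6 : E.a₆ = 0) :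
    E.toAffine.Equation 0 0 ∧ ∀ n : ℤ, W n = (E.Ψ n).evalEval 0 0 := by
  have h2 : W 2 ≠ 0 := fun h => hnd (by simp [h])
  have h3 : W 3 ≠ 0 := fun h => hnd (by simp [h])
  have hW0 : W 0 = 0 := by
    have h := hrec 1 1
    norm_num [hnorm] at h
    exact h.resolve_left h2
  have hWm1 : W (-1) = -1 := by
    have h := hrec 1 2
    norm_num [hnorm, hW0] at h
    have : W 3 * (W (-1) + 1) = 0 := by linear_combination h
    rcases mul_eq_zero.mp this with h' | h'
    · exact absurd h' h3
    · linear_combination h'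
  have hneg : ∀ n, W (-n) = -W n := by
    intro n
    have key : ∀ k, W k * (W (-k) + W k) = 0 := by
      intro k
      have h := hrec 0 k
      norm_num [hnorm, hW0, hWm1] at h
      linear_combination h
    rcases mul_eq_zero.mp (key n) with h | h
    · have h' := key (-n)
      rw [neg_neg, h, zero_add] at h'
      rw [h, mul_self_eq_zero.mp h', neg_zero]
    · linear_combination h
  have hodd : ∀ m, W (2 * m + 1) = W (m + 2) * W m ^ 3 - W (m - 1) * W (m + 1) ^ 3 := by
    intro m
    have h := hrec (m + 1) m
    rw [show m + 1 + m = 2 * m + 1 by ring, show m + 1 - m = 1 by ring,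
      show m + 1 + 1 = m + 2 by ring, show m + 1 - 1 = m by ring, hnorm] at h
    linear_combination h
  have heven : ∀ m, W (2 * m) * W 2 =
      W (m - 1) ^ 2 * W m * W (m + 2) - W (m - 2) * W m * W (m + 1) ^ 2 := by
    intro m
    have h := hrec (m + 1) (m - 1)
    rw [show m + 1 + (m - 1) = 2 * m by ring, show m + 1 - (m - 1) = 2 by ring,
      show m + 1 + 1 = m + 2 by ring, show m + 1 - 1 = m by ring,
      show m - 1 + 1 = m by ring, show m - 1 - 1 = m - 2 by ring] at h
    linear_combination h
  have heq : E.toAffine.Equation 0 0 := by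
    rw [WeierstrassCurve.Affine.equation_iff]
    simp [ha6]
  refine ⟨heq, ?_⟩
  have hψ2 : E.ψ₂.evalEval 0 0 = W 2 := by
    simp [WeierstrassCurve.ψ₂, WeierstrassCurve.Affine.evalEval_polynomialY, ha3]
  have hb8 : E.b₈ = W 3 := by
    simp only [WeierstrassCurve.b₈, ha1, ha2, ha3, ha4, ha6]
    field_simp
    ring
  have hV3 : (E.Ψ 3).evalEval 0 0 = W 3 := by
    rw [WeierstrassCurve.Ψ_three, evalEval_C]
    simp [WeierstrassCurve.Ψ₃, hb8]
  have hV4 : (E.Ψ 4).evalEval 0 0 = W 4 := by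
    rw [WeierstrassCurve.Ψ_four, evalEval_mul, evalEval_C, hψ2]
    simp [WeierstrassCurve.preΨ₄, hb8]
    simp only [WeierstrassCurve.b₄, WeierstrassCurve.b₆, ha1, ha3, ha4, ha6]
    field_simp
    ring
  have hVodd : ∀ m, (E.Ψ (2 * m + 1)).evalEval 0 0 =
      (E.Ψ (m + 2)).evalEval 0 0 * (E.Ψ m).evalEval 0 0 ^ 3
        - (E.Ψ (m - 1)).evalEval 0 0 * (E.Ψ (m + 1)).evalEval 0 0 ^ 3 := by
    intro m
    have h0 : E.toAffine.polynomial.evalEval 0 0 = 0 := heq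
    rw [WeierstrassCurve.Ψ_odd]
    simp [h0]
  have hVeven : ∀ m, (E.Ψ (2 * m)).evalEval 0 0 * W 2 =
      (E.Ψ (m - 1)).evalEval 0 0 ^ 2 * (E.Ψ m).evalEval 0 0 * (E.Ψ (m + 2)).evalEval 0 0
        - (E.Ψ (m - 2)).evalEval 0 0 * (E.Ψ m).evalEval 0 0 * (E.Ψ (m + 1)).evalEval 0 0 ^ 2 := by
    intro m
    have h := congrArg (evalEval 0 0) (E.Ψ_even m)
    simpa [hψ2] using h
  have hnat : ∀ n : ℕ, W n = (E.Ψ n).evalEval 0 0 := by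
    intro n
    induction n using Nat.strong_induction_on with
    | _ n ih =>
      have ih' : ∀ k : ℤ, 0 ≤ k → k < n → W k = (E.Ψ k).evalEval 0 0 := by
        intro k hk hkn
        lift k to ℕ using hk
        exact ih k (by exact_mod_cast hkn)
      by_cases hn : n < 5
      · interval_cases n
        · simp [hW0]
        · simp [hnorm]
        · simp [hψ2]
        · exact hV3.symm
        · exact hV4.symm
      · rcases Int.even_or_odd' (n : ℤ) with ⟨m, hm | hm⟩
        · rw [hm]
          apply mul_right_cancel₀ h2
          rw [heven, hVeven, ih' (m - 1) (by omega) (by omega), ih' m (by omega) (by omega),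
            ih' (m + 2) (by omega) (by omega), ih' (m - 2) (by omega) (by omega),
            ih' (m + 1) (by omega) (by omega)]
        · rw [hm, hodd, hVodd, ih' (m - 1) (by omega) (by omega), ih' m (by omega) (by omega),
            ih' (m + 2) (by omega) (by omega), ih' (m + 1) (by omega) (by omega)]
  intro n
  rcases Int.eq_nat_or_neg n with ⟨k, rfl | rfl⟩
  · exact hnat k
  · rw [hneg, WeierstrassCurve.Ψ_neg, hnat k]
    simp
end

section
/- Let q ∈ ℝ with 0 < q < 1 and let x > 0 be a real number such that log x / log q is not an integer. Then Sign[θ(x,q)] = (−1)^{⌊log x / log q⌋}, where ⌊·⌋ denotes the greatest integer function. -/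
/-- `θ(x,q) = (1−x)·∏_{m≥1} (1−qᵐx)(1−qᵐx⁻¹)/(1−qᵐ)²`. -/
noncomputable def theta (x q : ℝ) : ℝ :=
  (1 - x) * ∏' m : ℕ, ((1 - q ^ (m + 1) * x) * (1 - q ^ (m + 1) * x⁻¹) / (1 - q ^ (m + 1)) ^ 2)

lemma tail_pos (f : ℕ → ℝ) (hs : Summable (fun m => f m - 1)) (hp : ∀ m, 0 < f m) :
    0 < ∏' m, f m := by
  have h := Real.summable_log_one_add_of_summable hs
  simp only [add_sub_cancel] at h
  rw [← Real.rexp_tsum_eq_tprod hp h]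
  exact Real.exp_pos _

lemma tprod_form (f : ℕ → ℝ) (N : ℕ) (hs : Summable (fun m => f m - 1))
    (hn : ∀ m, m < N → f m < 0) (hp : ∀ m, N ≤ m → 0 < f m) :
    ∃ c : ℝ, 0 < c ∧ ∏' m, f m = (-1) ^ N * c := by
  have hs' : Summable (fun m => f (m + N) - 1) := (summable_nat_add_iff N).2 hs
  have hm : Multipliable (fun m => f (m + N)) := by
    have h := Real.multipliable_one_add_of_summable hs'
    simpa only [add_sub_cancel] using h
  refine ⟨(∏ i ∈ Finset.range N, (- f i)) * ∏' m, f (m + N), ?_, ?_⟩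
  · refine mul_pos (Finset.prod_pos fun i hi => ?_) (tail_pos _ hs' fun m => hp _ (by omega))
    have := hn i (Finset.mem_range.1 hi)
    linarith
  · rw [← hm.prod_mul_tprod_nat_mul', Finset.prod_neg, Finset.card_range, ← mul_assoc,
      ← mul_assoc, ← mul_pow]
    simp

lemma theta_summable (q x : ℝ) (hq0 : 0 < q) (hq1 : q < 1) (hx : 0 < x) :
    Summable (fun m : ℕ => (1 - q ^ (m + 1) * x) * (1 - q ^ (m + 1) * x⁻¹) /
      (1 - q ^ (m + 1)) ^ 2 - 1) := by
  have hg : Summable (fun m : ℕ => q ^ m * (|2 - x - x⁻¹| / (1 - q) ^ 2)) :=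
    (summable_geometric_of_lt_one hq0.le hq1).mul_right _
  refine Summable.of_norm_bounded hg fun m => ?_
  have h1 : q ^ (m + 1) ≤ q := by
    simpa using pow_le_pow_of_le_one hq0.le hq1.le (show 1 ≤ m + 1 by omega)
  have h2 : q ^ (m + 1) ≤ q ^ m := pow_le_pow_of_le_one hq0.le hq1.le (by omega)
  have h0 : 0 < q ^ (m + 1) := by positivity
  generalize q ^ (m + 1) = u at *
  have hu : 0 < 1 - u := by linarith
  have e : (1 - u * x) * (1 - u * x⁻¹) / (1 - u) ^ 2 - 1 = u * ((2 - x - x⁻¹) / (1 - u) ^ 2) := by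
    field_simp
    ring
  rw [e, Real.norm_eq_abs, abs_mul, abs_div, abs_of_pos h0, abs_of_pos (pow_pos hu 2)]
  have : 0 < 1 - q := by linarith
  gcongr

/-- For `0 < q < 1` and `x > 0` with `log x / log q` not an integer,
`Sign[θ(x,q)] = (−1)^⌊log x / log q⌋`. -/
theorem sign_theta_pos_q (q x : ℝ) (hq0 : 0 < q) (hq1 : q < 1) (hx : 0 < x)
    (hnot : ∀ k : ℤ, Real.log x / Real.log q ≠ (k : ℝ)) :
    Real.sign (theta x q) = (-1 : ℝ) ^ ⌊Real.log x / Real.log q⌋ := by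
  have hs := theta_summable q x hq0 hq1 hx
  have hlq : Real.log q < 0 := Real.log_neg hq0 hq1
  set a := Real.log x / Real.log q with ha
  have hxa : x = q ^ a := by
    rw [Real.rpow_def_of_pos hq0, ha, mul_div_cancel₀ _ hlq.ne, Real.exp_log hx]
  have e1 : ∀ m : ℕ, q ^ m * x = q ^ ((m : ℝ) + a) := fun m => by
    rw [Real.rpow_add hq0, Real.rpow_natCast, ← hxa]
  have e2 : ∀ m : ℕ, q ^ m * x⁻¹ = q ^ ((m : ℝ) - a) := fun m => by
    rw [Real.rpow_sub hq0, Real.rpow_natCast, ← hxa, div_eq_mul_inv]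
  have lt1 : ∀ t : ℝ, 0 < t → 0 < 1 - q ^ t := fun t ht => by
    linarith [Real.rpow_lt_one hq0.le hq1 ht]
  have gt1 : ∀ t : ℝ, t < 0 → 1 - q ^ t < 0 := fun t ht => by
    linarith [Real.one_lt_rpow_of_pos_of_lt_one_of_neg hq0 hq1 ht]
  have hd : ∀ m : ℕ, 0 < (1 - q ^ (m + 1)) ^ 2 := fun m => by
    have := pow_lt_one₀ hq0.le hq1 (show m + 1 ≠ 0 by omega)
    exact pow_pos (by linarith) 2
  have hfl : (⌊a⌋ : ℝ) < a := lt_of_le_of_ne (Int.floor_le a) (hnot _).symm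
  have hfu : a < ⌊a⌋ + 1 := Int.lt_floor_add_one a
  have key : ∀ N : ℕ, ∀ b c : ℝ, 0 < b → 0 < c → Real.sign (b * ((-1) ^ N * c)) = (-1) ^ N := by
    intro N b c hb hc
    rcases neg_one_pow_eq_or ℝ N with h | h <;> rw [h]
    · exact Real.sign_of_pos (by positivity)
    · exact Real.sign_of_neg (by nlinarith [mul_pos hb hc])
  generalize ⌊a⌋ = n at *
  have hx0 : x = q ^ a := hxa
  unfold theta
  rcases le_or_gt 0 n with hn | hn
  · obtain ⟨N, rfl⟩ := Int.eq_ofNat_of_zero_le hn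
    push_cast at hfl hfu
    have ha0 : 0 < a := lt_of_le_of_lt (Nat.cast_nonneg N) hfl
    obtain ⟨c, hc, h⟩ := tprod_form _ N hs
      (fun m hm => by
        have hm' : (m : ℝ) + 1 ≤ N := by exact_mod_cast hm
        refine div_neg_of_neg_of_pos (mul_neg_of_pos_of_neg ?_ ?_) (hd m)
        · rw [e1]; exact lt1 _ (by positivity)
        · rw [e2]; exact gt1 _ (by push_cast; linarith))
      (fun m hm => by
        have hm' : (N : ℝ) ≤ m := by exact_mod_cast hm
        refine div_pos (mul_pos ?_ ?_) (hd m)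
        · rw [e1]; exact lt1 _ (by positivity)
        · rw [e2]; exact lt1 _ (by push_cast; linarith))
    rw [h, key N _ c (by rw [hx0]; exact lt1 a ha0) hc]
    simp
  · obtain ⟨N, hN⟩ := Int.eq_ofNat_of_zero_le (show 0 ≤ -n - 1 by omega)
    obtain rfl : n = -((N : ℤ) + 1) := by omega
    push_cast at hfl hfu
    have ha0 : a < 0 := by
      have : (0:ℝ) ≤ N := Nat.cast_nonneg N
      linarith
    obtain ⟨c, hc, h⟩ := tprod_form _ N hs
      (fun m hm => by
        have hm' : (m : ℝ) + 1 ≤ N := by exact_mod_cast hm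
        refine div_neg_of_neg_of_pos (mul_neg_of_neg_of_pos ?_ ?_) (hd m)
        · rw [e1]; exact gt1 _ (by push_cast; linarith)
        · rw [e2]; exact lt1 _ (by push_cast; linarith [Nat.cast_nonneg (α := ℝ) m]))
      (fun m hm => by
        have hm' : (N : ℝ) ≤ m := by exact_mod_cast hm
        refine div_pos (mul_pos ?_ ?_) (hd m)
        · rw [e1]; exact lt1 _ (by push_cast; linarith)
        · rw [e2]; exact lt1 _ (by push_cast; linarith [Nat.cast_nonneg (α := ℝ) m]))
    have hb : 0 < -(1 - x) := by
      have := gt1 a ha0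
      rw [← hx0] at this
      linarith
    have e : (1 - x) * ((-1) ^ N * c) = -(1 - x) * ((-1) ^ (N + 1) * c) := by ring
    rw [h, e, key (N + 1) _ c hb hc, zpow_neg, ← inv_zpow]
    norm_num
    exact_mod_cast rfl
end

section
/- Let q ∈ ℝ with −1 < q < 0 and let x > 0 be a real number. Then θ(x,q) and θ(x,q²) have the same sign; that is, θ(x,q) > 0 if and only if θ(x,q²) > 0, and θ(x,q) = 0 if and only if θ(x,q²) = 0. -/
/-- For `−1 < q < 0` and `x > 0`, `θ(x,q)` and `θ(x,q²)` have the same sign. -/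
theorem theta_sign_eq_theta_sq (q x : ℝ) (hq0 : -1 < q) (hq1 : q < 0) (hx : 0 < x) :
    (0 < theta x q ↔ 0 < theta x (q ^ 2)) ∧ (theta x q = 0 ↔ theta x (q ^ 2) = 0) := by
  have habs : |q| < 1 := abs_lt.mpr ⟨hq0, by linarith⟩
  set f : ℕ → ℝ := fun m =>
    (1 - q ^ (m + 1) * x) * (1 - q ^ (m + 1) * x⁻¹) / (1 - q ^ (m + 1)) ^ 2 with hf
  set g : ℕ → ℝ := fun m => f m - 1 with hg
  have hfg : ∀ m, f m = 1 + g m := fun m => by simp [hg]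
  have hpow : ∀ m : ℕ, |q ^ (m + 1)| ≤ |q| := fun m => by
    rw [abs_pow]
    exact pow_le_of_le_one (abs_nonneg _) habs.le (by omega)
  have hden : ∀ m : ℕ, 1 - |q| ≤ 1 - q ^ (m + 1) := fun m => by
    have := hpow m
    have := le_abs_self (q ^ (m + 1))
    linarith
  have hpos : 0 < 1 - |q| := by linarith
  have hgs : Summable g := by
    have h1 : Summable fun m : ℕ => |q| ^ m * (|q| * |2 - x - x⁻¹| / (1 - |q|) ^ 2) :=
      (summable_geometric_of_lt_one (abs_nonneg q) habs).mul_right _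
    refine h1.of_norm_bounded (fun m => ?_)
    have hd := hden m
    have hd0 : 1 - q ^ (m + 1) ≠ 0 := by linarith
    have e : g m = q ^ (m + 1) * (2 - x - x⁻¹) / (1 - q ^ (m + 1)) ^ 2 := by
      simp only [hg, hf]
      rw [div_sub_one (pow_ne_zero 2 hd0)]
      congr 1
      have : x * x⁻¹ = 1 := mul_inv_cancel₀ hx.ne'
      linear_combination (q ^ (m + 1)) ^ 2 * this
    rw [e, Real.norm_eq_abs, abs_div, abs_mul, abs_pow, abs_of_nonneg (sq_nonneg (1 - q ^ (m + 1)))]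
    rw [← mul_div_assoc, ← mul_assoc, ← pow_succ]
    gcongr
  have hie : Function.Injective (fun k : ℕ => 2 * k) := fun a b h => by
    simp only at h; omega
  have hio : Function.Injective (fun k : ℕ => 2 * k + 1) := fun a b h => by
    simp only at h; omega
  have hse : Summable fun k => g (2 * k) := hgs.comp_injective hie
  have hso : Summable fun k => g (2 * k + 1) := hgs.comp_injective hio
  have he : Multipliable fun k => f (2 * k) := by
    simp only [hfg]; exact Real.multipliable_one_add_of_summable hse
  have ho : Multipliable fun k => f (2 * k + 1) := by
    simp only [hfg]; exact Real.multipliable_one_add_of_summable hso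
  have hfpos : ∀ k, 0 < f (2 * k) := fun k => by
    have hneg : q ^ (2 * k + 1) < 0 := Odd.pow_neg ⟨k, rfl⟩ hq1
    have a1 : q ^ (2 * k + 1) * x < 0 := mul_neg_of_neg_of_pos hneg hx
    have a2 : q ^ (2 * k + 1) * x⁻¹ < 0 := mul_neg_of_neg_of_pos hneg (inv_pos.mpr hx)
    simp only [hf]
    exact div_pos (mul_pos (by linarith) (by linarith)) (pow_pos (by linarith) 2)
  have hP : 0 < ∏' k, f (2 * k) := by
    rw [← Real.rexp_tsum_eq_tprod hfpos]
    · exact Real.exp_pos _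
    · simp only [hfg]; exact Real.summable_log_one_add_of_summable hse
  have hsq : theta x (q ^ 2) = (1 - x) * ∏' k, f (2 * k + 1) := by
    unfold theta
    congr 1
    refine tprod_congr (fun k => ?_)
    have : (q ^ 2) ^ (k + 1) = q ^ (2 * k + 1 + 1) := by rw [← pow_mul]; congr 1
    simp only [hf, this]
  have key : theta x q = (∏' k, f (2 * k)) * theta x (q ^ 2) := by
    have : theta x q = (1 - x) * ∏' k, f k := rfl
    rw [this, hsq, ← tprod_even_mul_odd he ho]
    ring
  rw [key]
  exact ⟨mul_pos_iff_of_pos_left hP, by simp [hP.ne']⟩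
end

section
/- Let q ∈ ℝ with 0 < q < 1, let n ≥ 1, and let u₁,…,uₙ be nonzero real numbers with u₁,…,u_k < 0 and u_{k+1},…,uₙ > 0 for some 0 ≤ k ≤ n. Set βᵢ = log|uᵢ| / log q for each i, and assume that 1, β₁,…,βₙ are linearly independent over ℚ. Then for every nonzero v = (v₁,…,vₙ) ∈ ℤⁿ: if v₁ + ⋯ + v_k is even, then Sign[θ(∏ᵢ uᵢ^{vᵢ}, q)] = (−1)^{⌊Σᵢ vᵢβᵢ⌋}; and if v₁ + ⋯ + v_k is odd, then θ(∏ᵢ uᵢ^{vᵢ}, q) > 0. -/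
open Finset

lemma aux_prod_pos {f : ℕ → ℝ} (hf : Summable f) (h : ∀ i, 0 < 1 + f i) :
    0 < ∏' i, (1 + f i) := by
  rw [← Real.rexp_tsum_eq_tprod h (Real.summable_log_one_add_of_summable hf)]
  exact Real.exp_pos _

noncomputable def auxG (q y : ℝ) : ℝ := ∏' m : ℕ, (1 - q ^ m * y)

lemma aux_summable {q : ℝ} (hq0 : 0 < q) (hq1 : q < 1) (y : ℝ) :
    Summable fun m : ℕ => -(q ^ m * y) :=
  ((summable_geometric_of_lt_one hq0.le hq1).mul_right y).neg

lemma aux_mult {q : ℝ} (hq0 : 0 < q) (hq1 : q < 1) (y : ℝ) :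
    Multipliable fun m : ℕ => (1 - q ^ m * y) := by
  simpa [sub_eq_add_neg] using
    Real.multipliable_one_add_of_summable (aux_summable hq0 hq1 y)

lemma auxG_pos {q : ℝ} (hq0 : 0 < q) (hq1 : q < 1) {y : ℝ} (hy : y < 1) : 0 < auxG q y := by
  have := aux_prod_pos (aux_summable hq0 hq1 y) (fun i => by
    have h1 : 0 < q ^ i := by positivity
    have h2 : q ^ i ≤ 1 := pow_le_one₀ hq0.le hq1.le
    nlinarith)
  simpa [auxG, sub_eq_add_neg] using this

lemma auxG_step {q : ℝ} (hq0 : 0 < q) (hq1 : q < 1) (y : ℝ) :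
    auxG q y = (1 - y) * auxG q (q * y) := by
  have he : ∀ m : ℕ, 1 - q ^ (m + 1) * y = 1 - q ^ m * (q * y) := fun m => by ring
  unfold auxG
  rw [tprod_eq_zero_mul']
  · simp only [he]; simp
  · simp only [he]; exact aux_mult hq0 hq1 _

lemma aux_theta {q : ℝ} (hq0 : 0 < q) (hq1 : q < 1) :
    ∃ D : ℝ, 0 < D ∧ ∀ x : ℝ, theta x q = auxG q x * auxG q (q * x⁻¹) * D := by
  have hlt : ∀ m : ℕ, q ^ (m + 1) ≤ q := fun m => by
    have h2 : q ^ m ≤ 1 := pow_le_one₀ hq0.le hq1.le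
    rw [pow_succ]; nlinarith
  have hs : Summable fun m : ℕ => q ^ (m + 1) / (1 - q ^ (m + 1)) := by
    refine Summable.of_nonneg_of_le (f := fun m : ℕ => q ^ m * (q / (1 - q))) ?_ ?_
      ((summable_geometric_of_lt_one hq0.le hq1).mul_right _)
    · intro m
      have := hlt m
      have : 0 < q ^ (m + 1) := by positivity
      exact div_nonneg this.le (by linarith)
    · intro m
      have h1 := hlt m
      rw [← mul_div_assoc, ← pow_succ]
      have : 0 < q ^ (m + 1) := by positivity
      exact div_le_div_of_nonneg_left this.le (by linarith) (by linarith)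
  have hm := Real.multipliable_one_add_of_summable hs
  have hp := aux_prod_pos hs (fun m => by
      have := hlt m
      have : 0 < q ^ (m + 1) := by positivity
      have : 0 ≤ q ^ (m + 1) / (1 - q ^ (m + 1)) := div_nonneg this.le (by linarith)
      linarith)
  refine ⟨_, mul_pos hp hp, fun x => ?_⟩
  rw [auxG_step hq0 hq1 x, mul_assoc, mul_assoc, theta]
  congr 1
  have m1 := aux_mult hq0 hq1 (q * x)
  have m2 := aux_mult hq0 hq1 (q * x⁻¹)
  unfold auxG
  rw [← hm.tprod_mul hm, ← m2.tprod_mul (hm.mul hm), ← m1.tprod_mul (m2.mul (hm.mul hm))]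
  refine tprod_congr fun m => ?_
  have h1 := hlt m
  have h2 : 1 - q ^ (m + 1) ≠ 0 := by
    intro h; linarith
  have h3 : 1 + q ^ (m + 1) / (1 - q ^ (m + 1)) = (1 - q ^ (m + 1))⁻¹ := by
    field_simp; ring
  rw [h3, div_eq_mul_inv, ← inv_pow]
  generalize (1 - q ^ (m + 1))⁻¹ = c
  ring

lemma aux_theta_step {q : ℝ} (hq0 : 0 < q) (hq1 : q < 1) {x : ℝ} (hx : 0 < x) (hx1 : x ≠ 1) :
    theta (q * x) q = - (x⁻¹ * theta x q) := by
  obtain ⟨D, hD, h⟩ := aux_theta hq0 hq1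
  have e : q * (q * x)⁻¹ = x⁻¹ := by field_simp
  rw [h, h, e, auxG_step hq0 hq1 x, auxG_step hq0 hq1 x⁻¹]
  field_simp
  ring

lemma aux_theta_pos {q : ℝ} (hq0 : 0 < q) (hq1 : q < 1) {x : ℝ} (hx : x < 1)
    (hx1 : q * x⁻¹ < 1) : 0 < theta x q := by
  obtain ⟨D, hD, h⟩ := aux_theta hq0 hq1
  rw [h]
  exact mul_pos (mul_pos (auxG_pos hq0 hq1 hx) (auxG_pos hq0 hq1 hx1)) hD

lemma aux_sign {q : ℝ} (hq0 : 0 < q) (hq1 : q < 1) {r : ℝ} (hr0 : 0 < r) (hr1 : r < 1) (N : ℤ) :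
    0 < (-1 : ℝ) ^ N * theta (q ^ ((N : ℝ) + r)) q := by
  have key : ∀ N : ℤ, ∃ c : ℝ, 0 < c ∧ (-1 : ℝ) ^ (N + 1) * theta (q ^ (((N + 1 : ℤ) : ℝ) + r)) q =
      c * ((-1 : ℝ) ^ N * theta (q ^ ((N : ℝ) + r)) q) := by
    intro N
    have hp : 0 < q ^ ((N : ℝ) + r) := Real.rpow_pos_of_pos hq0 _
    refine ⟨(q ^ ((N : ℝ) + r))⁻¹, by positivity, ?_⟩
    have e : q ^ (((N + 1 : ℤ) : ℝ) + r) = q * q ^ ((N : ℝ) + r) := by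
      rw [show ((N + 1 : ℤ) : ℝ) + r = 1 + ((N : ℝ) + r) by push_cast; ring,
        Real.rpow_add hq0, Real.rpow_one]
    have hne : q ^ ((N : ℝ) + r) ≠ 1 := by
      intro h
      have h2 := congrArg Real.log h
      rw [Real.log_rpow hq0, Real.log_one] at h2
      have h3 : Real.log q < 0 := Real.log_neg hq0 hq1
      have h4 : (N : ℝ) + r = 0 := by
        rcases mul_eq_zero.1 h2 with h | h
        · exact h
        · linarith
      have h5 : (-1 : ℝ) < N := by linarith
      have h6 : (N : ℝ) < 0 := by linarith
      have h7 : (-1 : ℤ) < N := by exact_mod_cast h5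
      have h8 : N < 0 := by exact_mod_cast h6
      omega
    rw [e, aux_theta_step hq0 hq1 hp hne, zpow_add₀ (by norm_num)]
    simp only [zpow_one]
    ring
  induction N using Int.induction_on with
  | zero =>
    simp only [zpow_zero, one_mul, Int.cast_zero, zero_add]
    have hp : 0 < q ^ r := Real.rpow_pos_of_pos hq0 _
    refine aux_theta_pos hq0 hq1 (Real.rpow_lt_one hq0.le hq1 hr0) ?_
    rw [← div_eq_mul_inv, div_lt_one hp]
    simpa using Real.rpow_lt_rpow_of_exponent_gt hq0 hq1 hr1
  | succ i ih =>
    obtain ⟨c, hc, h⟩ := key i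
    rw [h]; exact mul_pos hc ih
  | pred i ih =>
    obtain ⟨c, hc, h⟩ := key (-(i : ℤ) - 1)
    rw [sub_add_cancel] at h
    rw [h] at ih
    exact (pos_iff_pos_of_mul_pos ih).1 hc

/-- For `0 < q < 1`, nonzero reals `u₁,…,uₙ` with `u₁,…,u_k < 0` and `u_{k+1},…,uₙ > 0`,
and `βᵢ = log|uᵢ|/log q` such that `1, β₁,…,βₙ` are linearly independent over `ℚ`:
for every nonzero `v ∈ ℤⁿ`, if `v₁+⋯+v_k` is even then
`Sign[θ(∏ uᵢ^{vᵢ}, q)] = (−1)^{⌊Σ vᵢβᵢ⌋}`, and if it is odd then `θ(∏ uᵢ^{vᵢ}, q) > 0`. -/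
theorem sign_theta_prod_pos_q (q : ℝ) (hq0 : 0 < q) (hq1 : q < 1)
    (n : ℕ) (hn : 1 ≤ n) (k : ℕ) (hk : k ≤ n) (u : Fin n → ℝ)
    (hneg : ∀ i : Fin n, (i : ℕ) < k → u i < 0)
    (hpos : ∀ i : Fin n, k ≤ (i : ℕ) → 0 < u i)
    (β : Fin n → ℝ) (hβ : ∀ i, β i = Real.log |u i| / Real.log q)
    (hind : ∀ (c₀ : ℤ) (c : Fin n → ℤ),
      (c₀ : ℝ) + ∑ i, (c i : ℝ) * β i = 0 → c₀ = 0 ∧ ∀ i, c i = 0) :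
    ∀ v : Fin n → ℤ, v ≠ 0 →
      (Even (∑ i ∈ univ.filter fun i : Fin n => (i : ℕ) < k, v i) →
        Real.sign (theta (∏ i, u i ^ v i) q) = (-1 : ℝ) ^ ⌊∑ i, (v i : ℝ) * β i⌋) ∧
      (¬ Even (∑ i ∈ univ.filter fun i : Fin n => (i : ℕ) < k, v i) →
        0 < theta (∏ i, u i ^ v i) q) := by
  intro v hv
  have hu : ∀ i, u i ≠ 0 := fun i => by
    rcases lt_or_ge (i : ℕ) k with h | h
    · exact (hneg i h).ne
    · exact (hpos i h).ne'
  have hlq : Real.log q < 0 := Real.log_neg hq0 hq1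
  set s : ℝ := ∑ i, (v i : ℝ) * β i with hs
  have habs : ∏ i, |u i| ^ v i = q ^ s := by
    have hpp : ∀ i, 0 < |u i| ^ v i := fun i => zpow_pos (abs_pos.2 (hu i)) _
    apply Real.log_injOn_pos (Set.mem_Ioi.2 (Finset.prod_pos fun i _ => hpp i))
      (Set.mem_Ioi.2 (Real.rpow_pos_of_pos hq0 _))
    rw [Real.log_prod (fun i _ => (hpp i).ne'), Real.log_rpow hq0, hs, Finset.sum_mul]
    refine Finset.sum_congr rfl fun i _ => ?_
    rw [Real.log_zpow, hβ, mul_assoc, div_mul_cancel₀ _ hlq.ne]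
  have hx : ∏ i, u i ^ v i =
      (-1 : ℝ) ^ (∑ i ∈ univ.filter fun i : Fin n => (i : ℕ) < k, v i) * q ^ s := by
    have hz : ∀ (t : Finset (Fin n)), (-1 : ℝ) ^ (∑ i ∈ t, v i) = ∏ i ∈ t, (-1 : ℝ) ^ v i := by
      intro t
      induction t using Finset.induction_on with
      | empty => simp
      | insert a t ha ih => rw [sum_insert ha, prod_insert ha, zpow_add₀ (by norm_num), ih]
    rw [hz, ← habs, Finset.prod_filter, ← Finset.prod_mul_distrib]
    refine Finset.prod_congr rfl fun i _ => ?_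
    split_ifs with h
    · rw [← mul_zpow, abs_of_neg (hneg i h)]; simp
    · rw [one_mul, abs_of_pos (hpos i (not_lt.1 h))]
  have hqs : 0 < q ^ s := Real.rpow_pos_of_pos hq0 _
  constructor
  · intro he
    rw [hx, he.neg_one_zpow, one_mul]
    have hfr : Int.fract s ≠ 0 := by
      intro h
      have h1 : ((-⌊s⌋ : ℤ) : ℝ) + ∑ i, (v i : ℝ) * β i = 0 := by
        rw [← hs]; push_cast
        have := Int.floor_add_fract s
        linarith
      exact hv (funext (hind _ v h1).2)
    have h := aux_sign hq0 hq1 (lt_of_le_of_ne (Int.fract_nonneg s) hfr.symm)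
      (Int.fract_lt_one s) ⌊s⌋
    rw [Int.floor_add_fract] at h
    rcases Int.even_or_odd ⌊s⌋ with h2 | h2
    · rw [h2.neg_one_zpow] at h ⊢
      exact Real.sign_of_pos (by linarith)
    · rw [h2.neg_one_zpow] at h ⊢
      exact Real.sign_of_neg (by linarith)
  · intro ho
    rw [hx, (Int.not_even_iff_odd.1 ho).neg_one_zpow]
    have : -1 * q ^ s < 0 := by linarith
    refine aux_theta_pos hq0 hq1 (by linarith) ?_
    have := mul_neg_of_pos_of_neg hq0 (inv_lt_zero.2 this)
    linarith
end

section
/- Let q ∈ ℝ with −1 < q < 0, let n ≥ 1, and let u₁,…,uₙ be positive real numbers. Set βᵢ = log uᵢ / (2·log|q|) for each i, and assume that 1, β₁,…,βₙ are linearly independent over ℚ. Then for every nonzero v = (v₁,…,vₙ) ∈ ℤⁿ, Sign[θ(∏ᵢ uᵢ^{vᵢ}, q)] = (−1)^{⌊Σᵢ vᵢβᵢ⌋}. -/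
lemma aux_factor_pos (q x : ℝ) (hq0 : -1 < q) (hq1 : q < 0) (k : ℕ)
    (h1 : (q ^ 2) ^ (k + 1) < x) (h2 : x < (q ^ 2) ^ k) (m : ℕ) (hm : 2 * k ≤ m) :
    0 < 1 - q ^ (m + 1) * x⁻¹ := by
  have hr0 : 0 < q ^ 2 := by have := hq1.ne; positivity
  have hr1 : q ^ 2 < 1 := by nlinarith
  have hx : 0 < x := lt_trans (by positivity) h1
  rcases Nat.even_or_odd (m + 1) with he | ho
  · obtain ⟨j, hj⟩ := he
    have hj' : m + 1 = 2 * j := by omega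
    rw [hj', pow_mul]
    have : (q ^ 2) ^ j ≤ (q ^ 2) ^ (k + 1) :=
      pow_le_pow_of_le_one hr0.le hr1.le (by omega)
    rw [sub_pos, ← div_eq_mul_inv, div_lt_one hx]
    linarith
  · have := ho.pow_neg hq1
    have h3 : 0 < x⁻¹ := by positivity
    nlinarith

lemma aux_factor_pos' (q x : ℝ) (hq0 : -1 < q) (hq1 : q < 0)
    (hx : 0 < x) (hx1 : x < 1) (m : ℕ) :
    0 < 1 - q ^ (m + 1) * x := by
  have h : |q ^ (m + 1) * x| < 1 := by
    rw [abs_mul, abs_pow, abs_of_pos hx]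
    have : |q| < 1 := by rw [abs_lt]; constructor <;> linarith
    have h3 : |q| ^ (m + 1) ≤ 1 := pow_le_one₀ (abs_nonneg _) this.le
    nlinarith
  linarith [(abs_lt.mp h).2]

lemma aux_den_pos (q : ℝ) (hq0 : -1 < q) (hq1 : q < 0) (m : ℕ) :
    0 < 1 - q ^ (m + 1) := by
  have h : |q ^ (m + 1)| < 1 := by
    rw [abs_pow]
    have : |q| < 1 := by rw [abs_lt]; constructor <;> linarith
    exact pow_lt_one₀ (abs_nonneg _) this (by omega)
  linarith [(abs_lt.mp h).2]

lemma aux_log (q c : ℝ) (hq0 : -1 < q) (hq1 : q < 0) (N : ℕ) :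
    Summable fun m : ℕ => Real.log (1 - q ^ (m + N + 1) * c) := by
  have : Summable fun m : ℕ => -(q ^ (m + N + 1) * c) := by
    have h : Summable fun m : ℕ => q ^ m :=
      summable_geometric_of_abs_lt_one (by rw [abs_lt]; constructor <;> linarith)
    refine (((h.mul_left (q ^ (N + 1))).mul_right c).neg).congr fun m => ?_
    ring
  refine (Real.summable_log_one_add_of_summable this).congr fun m => ?_
  rw [← sub_eq_add_neg]

lemma aux_tprod (q x : ℝ) (hq0 : -1 < q) (hq1 : q < 0) (k : ℕ)
    (h1 : (q ^ 2) ^ (k + 1) < x) (h2 : x < (q ^ 2) ^ k) :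
    0 < (-1 : ℝ) ^ k *
      ∏' m : ℕ, ((1 - q ^ (m + 1) * x) * (1 - q ^ (m + 1) * x⁻¹) / (1 - q ^ (m + 1)) ^ 2) := by
  have hr0 : 0 < q ^ 2 := by have := hq1.ne; positivity
  have hr1 : q ^ 2 < 1 := by nlinarith
  have hx : 0 < x := lt_trans (by positivity) h1
  have hx1 : x < 1 := lt_of_lt_of_le h2 (pow_le_one₀ hr0.le hr1.le)
  set f : ℕ → ℝ := fun m =>
    (1 - q ^ (m + 1) * x) * (1 - q ^ (m + 1) * x⁻¹) / (1 - q ^ (m + 1)) ^ 2 with hf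
  have hA := aux_factor_pos' q x hq0 hq1 hx hx1
  have hD := aux_den_pos q hq0 hq1
  have hB := aux_factor_pos q x hq0 hq1 k h1 h2
  have hpos : ∀ m, 0 < f (m + 2 * k) := fun m =>
    div_pos (mul_pos (hA _) (hB _ (by omega))) (pow_pos (hD _) 2)
  have hsum : Summable fun m => Real.log (f (m + 2 * k)) := by
    have s1 := aux_log q x hq0 hq1 (2 * k)
    have s2 := aux_log q x⁻¹ hq0 hq1 (2 * k)
    have s3 := aux_log q 1 hq0 hq1 (2 * k)
    refine ((s1.add s2).sub (s3.mul_left 2)).congr fun m => ?_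
    have a := hA (m + 2 * k)
    have b := hB (m + 2 * k) (by omega)
    have d := hD (m + 2 * k)
    simp only [hf]
    rw [Real.log_div (mul_pos a b).ne' (pow_pos d 2).ne', Real.log_mul a.ne' b.ne', Real.log_pow]
    simp
  have hmul : Multipliable fun m => f (m + 2 * k) :=
    Real.multipliable_of_summable_log hpos hsum
  have htail : 0 < ∏' m, f (m + 2 * k) := by
    rw [← Real.rexp_tsum_eq_tprod hpos hsum]
    exact Real.exp_pos _
  have hfin : ∀ j, j ≤ k → 0 < (-1 : ℝ) ^ j * ∏ m ∈ Finset.range (2 * j), f m := by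
    intro j
    induction j with
    | zero => intro _; simp
    | succ j ih =>
      intro hj
      have ih := ih (by omega)
      have e : 2 * (j + 1) = 2 * j + 1 + 1 := by ring
      rw [e, Finset.prod_range_succ, Finset.prod_range_succ]
      have p1 : 0 < f (2 * j) := by
        refine div_pos (mul_pos (hA _) ?_) (pow_pos (hD _) 2)
        have : q ^ (2 * j + 1) < 0 := Odd.pow_neg ⟨j, rfl⟩ hq1
        have h3 : 0 < x⁻¹ := by positivity
        nlinarith
      have p2 : f (2 * j + 1) < 0 := by
        refine div_neg_of_neg_of_pos (mul_neg_of_pos_of_neg (hA _) ?_) (pow_pos (hD _) 2)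
        rw [← e, pow_mul, sub_neg, ← div_eq_mul_inv, one_lt_div hx]
        exact lt_of_lt_of_le h2 (pow_le_pow_of_le_one hr0.le hr1.le hj)
      have key : ∀ a b c d : ℝ, 0 < a * b → 0 < c → d < 0 → 0 < a * (-1) * (b * c * d) := by
        intro a b c d h h' h2
        have := mul_pos (mul_pos h h') (neg_pos.mpr h2)
        linarith
      rw [pow_succ]
      exact key _ _ _ _ ih p1 p2
  rw [← hmul.prod_mul_tprod_nat_mul', ← mul_assoc]
  exact mul_pos (hfin k le_rfl) htail

lemma aux_sign_s8 (t : ℝ) (k : ℕ) (h : 0 < (-1 : ℝ) ^ k * t) : Real.sign t = (-1) ^ k := by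
  rcases neg_one_pow_eq_or ℝ k with e | e
  · rw [e] at h ⊢
    exact Real.sign_of_pos (by linarith)
  · rw [e] at h ⊢
    exact Real.sign_of_neg (by linarith)

/-- For `−1 < q < 0`, positive reals `u₁,…,uₙ`, and `βᵢ = log uᵢ/(2·log|q|)` with
`1, β₁,…,βₙ` linearly independent over `ℚ`: for every nonzero `v ∈ ℤⁿ`,
`Sign[θ(∏ uᵢ^{vᵢ}, q)] = (−1)^{⌊Σ vᵢβᵢ⌋}`. -/
theorem sign_theta_prod_neg_q (q : ℝ) (hq0 : -1 < q) (hq1 : q < 0)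
    (n : ℕ) (hn : 1 ≤ n) (u : Fin n → ℝ) (hpos : ∀ i, 0 < u i)
    (β : Fin n → ℝ) (hβ : ∀ i, β i = Real.log (u i) / (2 * Real.log |q|))
    (hind : ∀ (c₀ : ℤ) (c : Fin n → ℤ),
      (c₀ : ℝ) + ∑ i, (c i : ℝ) * β i = 0 → c₀ = 0 ∧ ∀ i, c i = 0) :
    ∀ v : Fin n → ℤ, v ≠ 0 →
      Real.sign (theta (∏ i, u i ^ v i) q) = (-1 : ℝ) ^ ⌊∑ i, (v i : ℝ) * β i⌋ := by
  intro v hv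
  have hr0 : 0 < q ^ 2 := by have := hq1.ne; positivity
  have hr1 : q ^ 2 < 1 := by nlinarith
  have hlr : Real.log (q ^ 2) = 2 * Real.log |q| := by
    rw [← sq_abs, Real.log_pow]; simp
  have hlneg : Real.log (q ^ 2) < 0 := Real.log_neg hr0 hr1
  set s := ∑ i, (v i : ℝ) * β i with hs
  set x := ∏ i, u i ^ v i with hxdef
  have hx : 0 < x := Finset.prod_pos fun i _ => zpow_pos (hpos i) _
  have hlogx : Real.log x = s * Real.log (q ^ 2) := by
    rw [hxdef, Real.log_prod (fun i _ => (zpow_pos (hpos i) _).ne'), hs, Finset.sum_mul]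
    refine Finset.sum_congr rfl fun i _ => ?_
    rw [Real.log_zpow, hβ, ← hlr]
    have := hlneg.ne
    rw [mul_assoc, div_mul_cancel₀ _ this]
  have hne : (⌊s⌋ : ℝ) ≠ s := by
    intro h
    have := hind (-⌊s⌋) v (by rw [← hs]; push_cast; linarith)
    exact hv (funext this.2)
  have hlt : (⌊s⌋ : ℝ) < s := lt_of_le_of_ne (Int.floor_le s) hne
  have hlt2 : s < ⌊s⌋ + 1 := Int.lt_floor_add_one s
  have hlow : (q ^ 2) ^ (⌊s⌋ + 1) < x := by
    rw [← Real.log_lt_log_iff (zpow_pos hr0 _) hx, Real.log_zpow, hlogx]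
    push_cast
    exact mul_lt_mul_of_neg_right hlt2 hlneg
  have hup : x < (q ^ 2) ^ ⌊s⌋ := by
    rw [← Real.log_lt_log_iff hx (zpow_pos hr0 _), Real.log_zpow, hlogx]
    exact mul_lt_mul_of_neg_right hlt hlneg
  generalize ⌊s⌋ = K at hlow hup
  rcases K with k | k
  · have h1 : (q ^ 2) ^ (k + 1) < x := by
      have := hlow
      rw [Int.ofNat_eq_natCast] at this
      exact_mod_cast this
    have h2 : x < (q ^ 2) ^ k := by
      rw [Int.ofNat_eq_natCast, zpow_natCast] at hup
      exact hup
    rw [Int.ofNat_eq_natCast, zpow_natCast]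
    apply aux_sign_s8
    have hx1 : x < 1 := lt_of_lt_of_le h2 (pow_le_one₀ hr0.le hr1.le)
    have := mul_pos (sub_pos.mpr hx1) (aux_tprod q x hq0 hq1 k h1 h2)
    unfold theta
    rw [mul_left_comm]
    exact this
  · have h1 : (q ^ 2) ^ (k + 1) < x⁻¹ := by
      rw [zpow_negSucc] at hup
      exact (lt_inv_comm₀ hx (by positivity)).mp hup
    have h2 : x⁻¹ < (q ^ 2) ^ k := by
      have e : Int.negSucc k + 1 = -(k : ℤ) := by omega
      rw [e, zpow_neg, zpow_natCast] at hlow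
      exact (inv_lt_comm₀ (by positivity) hx).mp hlow
    have hx1 : 1 < x := by
      have : x⁻¹ < 1 := lt_of_lt_of_le h2 (pow_le_one₀ hr0.le hr1.le)
      exact (inv_lt_one₀ hx).mp this
    rw [zpow_negSucc, ← inv_pow, inv_neg_one]
    apply aux_sign_s8
    have := mul_pos (sub_pos.mpr hx1) (aux_tprod q x⁻¹ hq0 hq1 k h1 h2)
    rw [inv_inv] at this
    unfold theta
    simp only [mul_comm (1 - q ^ (_ + 1) * x⁻¹)] at this
    have key : ∀ a b c : ℝ, 0 < (a - 1) * (b * c) → 0 < b * (-1) * ((1 - a) * c) := by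
      intro a b c h
      linarith
    rw [pow_succ]
    exact key _ _ _ this
end

section
/- Let q ∈ ℝ with 0 < |q| < 1 and let u be a nonzero real number normalized so that q < |u| < 1 if q > 0, and q² < u < 1 (in particular u > 0) if q < 0. Then θ(u,q) > 0. -/
theorem theta_aux_summable (q c : ℝ) (hq1 : |q| < 1) :
    Summable (fun m : ℕ => Real.log (1 - q ^ (m + 1) * c)) := by
  have h : Summable (fun m : ℕ => -(q ^ (m + 1) * c)) := by
    have h1 : Summable (fun m : ℕ => q ^ m) := summable_geometric_of_abs_lt_one hq1
    exact (((summable_nat_add_iff 1).2 h1).mul_right c).neg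
  have := Real.summable_log_one_add_of_summable h
  simpa [sub_eq_add_neg] using this

theorem theta_aux_pow (q : ℝ) (hq0 : q ≠ 0) (hq1 : |q| < 1) (c : ℝ)
    (hp : 0 < q → |c| * q < 1) (hn : q < 0 → 0 < c ∧ q ^ 2 * c < 1) (m : ℕ) :
    0 < 1 - q ^ (m + 1) * c := by
  have hq := abs_lt.1 hq1
  rcases lt_or_gt_of_ne hq0 with h | h
  · obtain ⟨hc, h2⟩ := hn h
    rcases Nat.even_or_odd (m + 1) with he | ho
    · obtain ⟨k, hk⟩ := he
      obtain ⟨j, rfl⟩ : ∃ j, k = j + 1 := ⟨k - 1, by omega⟩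
      have e : q ^ (m + 1) = (q ^ 2) ^ j * q ^ 2 := by
        rw [hk, ← pow_mul, ← pow_add]; congr 1; ring
      have : (q ^ 2) ^ j ≤ 1 := pow_le_one₀ (by positivity) (by nlinarith)
      have h3 : 0 < q ^ 2 * c := by positivity
      rw [e]
      nlinarith
    · have := ho.pow_neg h
      nlinarith
  · have h1 := hp h
    have h2 : q ^ m ≤ 1 := pow_le_one₀ h.le hq.2.le
    have h3 : 0 ≤ q ^ m := by positivity
    have h4 : c ≤ |c| := le_abs_self c
    have h5 : q * c ≤ |c| * q := by nlinarith
    have h6 : 0 ≤ |c| * q := by positivity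
    have e : q ^ (m + 1) * c = q ^ m * (q * c) := by ring
    rw [e]
    nlinarith

/-- For `0 < |q| < 1` and a nonzero real `u` normalized so that `q < |u| < 1` if `q > 0`
and `q² < u < 1` if `q < 0`, we have `θ(u,q) > 0`. -/
theorem theta_pos_of_normalized (q u : ℝ) (hq0 : 0 < |q|) (hq1 : |q| < 1) (hu : u ≠ 0)
    (hpos : 0 < q → q < |u| ∧ |u| < 1)
    (hneg : q < 0 → q ^ 2 < u ∧ u < 1) :
    0 < theta u q := by
  have hq : q ≠ 0 := abs_pos.1 hq0
  have hb := abs_lt.1 hq1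
  have ha : ∀ m : ℕ, 0 < 1 - q ^ (m + 1) * u := by
    refine theta_aux_pow q hq hq1 u (fun h => ?_) (fun h => ?_)
    · have := hpos h
      nlinarith [abs_nonneg u]
    · have := hneg h
      have h2 : 0 < q ^ 2 := by positivity
      exact ⟨by linarith, by nlinarith⟩
  have hi : ∀ m : ℕ, 0 < 1 - q ^ (m + 1) * u⁻¹ := by
    refine theta_aux_pow q hq hq1 u⁻¹ (fun h => ?_) (fun h => ?_)
    · have := hpos h
      rw [abs_inv, inv_mul_eq_div, div_lt_one (by positivity)]
      exact this.1
    · have := hneg h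
      have h2 : 0 < q ^ 2 := by positivity
      have h3 : 0 < u := by linarith
      refine ⟨by positivity, ?_⟩
      rw [← div_eq_mul_inv, div_lt_one h3]
      exact this.1
  have hc : ∀ m : ℕ, 0 < 1 - q ^ (m + 1) := fun m => by
    have h1 : |q ^ (m + 1)| < 1 := by
      rw [abs_pow]; exact pow_lt_one₀ (abs_nonneg q) hq1 (by omega)
    linarith [(abs_lt.1 h1).2]
  have hu1 : 0 < 1 - u := by
    rcases lt_or_gt_of_ne hq with h | h
    · linarith [(hneg h).2]
    · linarith [(hpos h).2, le_abs_self u]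
  have hf : ∀ m : ℕ, 0 < (1 - q ^ (m + 1) * u) * (1 - q ^ (m + 1) * u⁻¹)
      / (1 - q ^ (m + 1)) ^ 2 := fun m =>
    div_pos (mul_pos (ha m) (hi m)) (pow_pos (hc m) 2)
  have hs : Summable (fun m : ℕ => Real.log ((1 - q ^ (m + 1) * u) * (1 - q ^ (m + 1) * u⁻¹)
      / (1 - q ^ (m + 1)) ^ 2)) := by
    have h := ((theta_aux_summable q u hq1).add (theta_aux_summable q u⁻¹ hq1)).sub
      ((theta_aux_summable q 1 hq1).mul_left 2)
    refine h.congr (fun m => ?_)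
    rw [Real.log_div (mul_pos (ha m) (hi m)).ne' (pow_pos (hc m) 2).ne',
      Real.log_mul (ha m).ne' (hi m).ne', Real.log_pow]
    simp
  unfold theta
  rw [← Real.rexp_tsum_eq_tprod hf hs]
  exact mul_pos hu1 (Real.exp_pos _)
end

section
/- Let q ∈ ℝ with 0 < |q| < 1 and let u, u' be nonzero real numbers, with u, u' > 0 in case q < 0. Define β = log|u| / log q and β' = log|u'| / log q if q > 0, and β = log u / (2·log|q|) and β' = log u' / (2·log|q|) if q < 0. If u·u' > 0 and β + β' is not an integer, then Sign[θ(u·u', q)] = (−1)^{⌊β+β'⌋}; and if u·u' < 0, then θ(u·u', q) > 0. -/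
/-- The factors of the product. -/
noncomputable def thF (q x : ℝ) (m : ℕ) : ℝ :=
  (1 - q ^ (m + 1) * x) * (1 - q ^ (m + 1) * x⁻¹) / (1 - q ^ (m + 1)) ^ 2

lemma one_sub_pow_pos (q : ℝ) (hq1 : |q| < 1) (m : ℕ) : 0 < 1 - q ^ (m + 1) := by
  have h1 : |q ^ (m + 1)| < 1 := by
    rw [abs_pow]; exact pow_lt_one₀ (abs_nonneg q) hq1 (by omega)
  have := (abs_lt.mp h1).2
  linarith

lemma thF_summable (q x : ℝ) (hq1 : |q| < 1) (hx : x ≠ 0) :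
    Summable (fun m => thF q x m - 1) := by
  have hg : Summable (fun m : ℕ => |q| ^ m * (|2 - x - x⁻¹| / (1 - |q|) ^ 2)) :=
    (summable_geometric_of_lt_one (abs_nonneg q) hq1).mul_right _
  refine Summable.of_norm_bounded hg (fun m => ?_)
  have hp := one_sub_pow_pos q hq1 m
  have e : thF q x m - 1 = q ^ (m + 1) * ((2 - x - x⁻¹) / (1 - q ^ (m + 1)) ^ 2) := by
    unfold thF
    field_simp
    ring
  rw [e, Real.norm_eq_abs, abs_mul, abs_div, abs_pow, abs_pow, abs_of_pos hp]
  have h1 : |q| ^ (m + 1) ≤ |q| ^ m := pow_le_pow_of_le_one (abs_nonneg q) hq1.le (by omega)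
  have h2 : 1 - |q| ≤ 1 - q ^ (m + 1) := by
    have a1 : q ^ (m + 1) ≤ |q| ^ (m + 1) := by rw [← abs_pow]; exact le_abs_self _
    have a2 : |q| ^ (m + 1) ≤ |q| ^ 1 := pow_le_pow_of_le_one (abs_nonneg q) hq1.le (by omega)
    simp only [pow_one] at a2
    linarith
  have h3 : 0 < 1 - |q| := by linarith
  gcongr

lemma thF_tprod (q x : ℝ) (hq1 : |q| < 1) (hx : x ≠ 0) (N : ℕ)
    (hpos : ∀ m, N ≤ m → 0 < thF q x m) :
    ∃ t : ℝ, 0 < t ∧ ∏' m, thF q x m = (∏ m ∈ Finset.range N, thF q x m) * t := by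
  have hs := (summable_nat_add_iff N).2 (thF_summable q x hq1 hx)
  have hl : Summable (fun m => Real.log (thF q x (m + N))) := by
    have := Real.summable_log_one_add_of_summable hs
    simpa using this
  have hp : ∀ m, 0 < thF q x (m + N) := fun m => hpos _ (by omega)
  have hm : Multipliable (fun m => thF q x (m + N)) := Real.multipliable_of_summable_log hp hl
  refine ⟨∏' m, thF q x (m + N), ?_, ?_⟩
  · rw [← Real.rexp_tsum_eq_tprod hp hl]; exact Real.exp_pos _
  · exact (hm.prod_mul_tprod_nat_mul').symm

lemma thF_inv (q x : ℝ) (m : ℕ) : thF q x⁻¹ m = thF q x m := by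
  unfold thF
  rw [inv_inv, mul_comm (1 - q ^ (m + 1) * x⁻¹)]

lemma thF_pos (q x : ℝ) (hq1 : |q| < 1) (m : ℕ) (hx : 0 < x) (h1 : q ^ (m + 1) * x < 1)
    (h2 : q ^ (m + 1) < x) : 0 < thF q x m := by
  unfold thF
  have hp := one_sub_pow_pos q hq1 m
  have h3 : q ^ (m + 1) * x⁻¹ < 1 := by rwa [← div_eq_mul_inv, div_lt_one hx]
  have h4 : 0 < 1 - q ^ (m + 1) * x := by linarith
  have h5 : 0 < 1 - q ^ (m + 1) * x⁻¹ := by linarith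
  positivity

lemma thF_neg (q x : ℝ) (hq1 : |q| < 1) (m : ℕ) (hx : 0 < x) (h1 : q ^ (m + 1) * x < 1)
    (h2 : x < q ^ (m + 1)) : thF q x m < 0 := by
  unfold thF
  have hp := one_sub_pow_pos q hq1 m
  have h3 : 1 < q ^ (m + 1) * x⁻¹ := by rwa [← div_eq_mul_inv, one_lt_div hx]
  have h4 : 0 < 1 - q ^ (m + 1) * x := by linarith
  have h5 : 1 - q ^ (m + 1) * x⁻¹ < 0 := by linarith
  exact div_neg_of_neg_of_pos (mul_neg_of_pos_of_neg h4 h5) (by positivity)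

lemma prod_sign1 (f : ℕ → ℝ) (n : ℕ) (h : ∀ k < n, f k < 0) :
    0 < (-1 : ℝ) ^ n * ∏ m ∈ Finset.range n, f m := by
  induction n with
  | zero => simp
  | succ n ih =>
    rw [Finset.prod_range_succ, pow_succ]
    have := mul_pos (ih (fun k hk => h k (by omega))) (neg_pos.2 (h n (by omega)))
    linarith

lemma prod_sign2 (f : ℕ → ℝ) (n : ℕ) (h0 : ∀ k < n, 0 < f (2 * k))
    (h : ∀ k < n, f (2 * k + 1) < 0) :
    0 < (-1 : ℝ) ^ n * ∏ m ∈ Finset.range (2 * n), f m := by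
  induction n with
  | zero => simp
  | succ n ih =>
    rw [show 2 * (n + 1) = 2 * n + 1 + 1 by ring, Finset.prod_range_succ, Finset.prod_range_succ,
      pow_succ]
    have := mul_pos (mul_pos (ih (fun k hk => h0 k (by omega)) (fun k hk => h k (by omega)))
      (h0 n (by omega))) (neg_pos.2 (h n (by omega)))
    linarith

lemma tprod_sign_pos (q x : ℝ) (hq : 0 < q) (hq1 : q < 1) (n : ℕ) (h1 : q ^ (n + 1) < x)
    (h2 : x < q ^ n) : 0 < (-1 : ℝ) ^ n * ∏' m, thF q x m := by
  have hx : 0 < x := lt_trans (by positivity) h1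
  have hx1 : x < 1 := lt_of_lt_of_le h2 (pow_le_one₀ hq.le hq1.le)
  have ha : |q| < 1 := by rwa [abs_of_pos hq]
  have hc : ∀ m : ℕ, q ^ (m + 1) * x < 1 := fun m =>
    mul_lt_one_of_nonneg_of_lt_one_right (pow_le_one₀ hq.le hq1.le) hx.le hx1
  obtain ⟨t, ht, e⟩ := thF_tprod q x ha hx.ne' n (fun m hm => thF_pos q x ha m hx (hc m)
    (lt_of_le_of_lt (pow_le_pow_of_le_one hq.le hq1.le (by omega)) h1))
  rw [e, ← mul_assoc]
  refine mul_pos (prod_sign1 _ n fun k hk => thF_neg q x ha k hx (hc k)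
    (lt_of_lt_of_le h2 (pow_le_pow_of_le_one hq.le hq1.le (by omega)))) ht

lemma tprod_sign_neg (q x : ℝ) (hq : q < 0) (hq1 : |q| < 1) (n : ℕ) (h1 : (q ^ 2) ^ (n + 1) < x)
    (h2 : x < (q ^ 2) ^ n) : 0 < (-1 : ℝ) ^ n * ∏' m, thF q x m := by
  have hQ : 0 < q ^ 2 := sq_pos_of_neg hq
  have hQ1 : q ^ 2 < 1 := by rwa [sq_lt_one_iff_abs_lt_one]
  have hx : 0 < x := lt_trans (by positivity) h1
  have hx1 : x < 1 := lt_of_lt_of_le h2 (pow_le_one₀ hQ.le hQ1.le)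
  have hc : ∀ m : ℕ, q ^ (m + 1) * x < 1 := fun m => by
    have := one_sub_pow_pos q hq1 m
    nlinarith
  have hodd : ∀ k : ℕ, 0 < thF q x (2 * k) := fun k => by
    have : q ^ (2 * k + 1) < 0 := Odd.pow_neg ⟨k, rfl⟩ hq
    exact thF_pos q x hq1 _ hx (hc _) (by linarith)
  have he : ∀ k : ℕ, q ^ (2 * k + 1 + 1) = (q ^ 2) ^ (k + 1) := fun k => by
    rw [← pow_mul]; congr 1
  obtain ⟨t, ht, e⟩ := thF_tprod q x hq1 hx.ne' (2 * n) (fun m hm => by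
    rcases Nat.even_or_odd' m with ⟨k, rfl | rfl⟩
    · exact hodd k
    · refine thF_pos q x hq1 _ hx (hc _) ?_
      rw [he]
      exact (lt_of_le_of_lt (pow_le_pow_of_le_one hQ.le hQ1.le (by omega)) h1))
  rw [e, ← mul_assoc]
  refine mul_pos (prod_sign2 _ n (fun k _ => hodd k) fun k hk => thF_neg q x hq1 _ hx (hc _) ?_) ht
  rw [he]
  exact (lt_of_lt_of_le h2 (pow_le_pow_of_le_one hQ.le hQ1.le (by omega)))

lemma sign_of_pos (y : ℝ) (n : ℤ) (h : 0 < (-1 : ℝ) ^ n * y) : Real.sign y = (-1 : ℝ) ^ n := by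
  rcases Int.even_or_odd n with hn | hn
  · rw [hn.neg_one_zpow] at h ⊢
    exact Real.sign_of_pos (by linarith)
  · rw [hn.neg_one_zpow] at h ⊢
    exact Real.sign_of_neg (by linarith)

lemma theta_sign (q Q x b : ℝ) (hQ : 0 < Q) (hQ1 : Q < 1) (hx : 0 < x)
    (H : ∀ (y : ℝ) (n : ℕ), Q ^ (n + 1) < y → y < Q ^ n → 0 < (-1 : ℝ) ^ n * ∏' m, thF q y m)
    (hb : b = Real.log x / Real.log Q) (hk : ∀ k : ℤ, b ≠ k) :
    Real.sign (theta x q) = (-1 : ℝ) ^ ⌊b⌋ := by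
  apply sign_of_pos
  change 0 < (-1 : ℝ) ^ ⌊b⌋ * ((1 - x) * ∏' m, thF q x m)
  have hlQ : Real.log Q < 0 := Real.log_neg hQ hQ1
  have hlx : Real.log x = b * Real.log Q := by rw [hb, div_mul_cancel₀ _ hlQ.ne]
  have h1 : x < Q ^ ⌊b⌋ := by
    rw [← Real.log_lt_log_iff hx (by positivity), Real.log_zpow, hlx]
    exact mul_lt_mul_of_neg_right (lt_of_le_of_ne (Int.floor_le b) (hk _).symm) hlQ
  have h2 : Q ^ (⌊b⌋ + 1) < x := by
    rw [← Real.log_lt_log_iff (by positivity) hx, Real.log_zpow, hlx]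
    push_cast
    exact mul_lt_mul_of_neg_right (Int.lt_floor_add_one b) hlQ
  generalize ⌊b⌋ = n at h1 h2
  rcases n with n | k
  · simp only [Int.ofNat_eq_natCast] at *
    rw [zpow_natCast] at h1 ⊢
    have h2' : Q ^ (n + 1) < x := by exact_mod_cast h2
    have hx1 : x < 1 := lt_of_lt_of_le h1 (pow_le_one₀ hQ.le hQ1.le)
    have := mul_pos (sub_pos.2 hx1) (H x n h2' h1)
    linarith
  · have e1 : Int.negSucc k + 1 = -(k : ℤ) := by rw [Int.negSucc_eq]; ring
    rw [e1, zpow_neg, zpow_natCast] at h2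
    rw [zpow_negSucc] at h1 ⊢
    have a1 : x⁻¹ < Q ^ k := inv_lt_of_inv_lt₀ (by positivity) h2
    have a2 : Q ^ (k + 1) < x⁻¹ := (lt_inv_comm₀ hx (by positivity)).1 h1
    have hx1 : 1 < x := lt_of_le_of_lt ((one_le_inv₀ (by positivity)).2
      (pow_le_one₀ hQ.le hQ1.le)) h2
    have h3 := H x⁻¹ k a2 a1
    simp only [thF_inv] at h3
    have := mul_pos (sub_pos.2 hx1) h3
    rw [← inv_pow, pow_succ, inv_neg, inv_one]
    linarith



/-- For `0 < |q| < 1` and nonzero reals `u, u'` (positive when `q < 0`), with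
`β, β'` given by `log|u|/log q, log|u'|/log q` if `q > 0` and by
`log u/(2 log|q|), log u'/(2 log|q|)` if `q < 0`: if `u·u' > 0` and `β + β'` is not an
integer then `Sign[θ(u·u', q)] = (−1)^{⌊β+β'⌋}`, and if `u·u' < 0` then `θ(u·u', q) > 0`. -/
theorem sign_theta_mul (q u u' : ℝ) (hq0 : 0 < |q|) (hq1 : |q| < 1)
    (hu : u ≠ 0) (hu' : u' ≠ 0)
    (hqneg : q < 0 → 0 < u ∧ 0 < u')
    (β β' : ℝ)
    (hβ : β = if 0 < q then Real.log |u| / Real.log q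
      else Real.log u / (2 * Real.log |q|))
    (hβ' : β' = if 0 < q then Real.log |u'| / Real.log q
      else Real.log u' / (2 * Real.log |q|)) :
    (0 < u * u' → (∀ k : ℤ, β + β' ≠ (k : ℝ)) →
      Real.sign (theta (u * u') q) = (-1 : ℝ) ^ ⌊β + β'⌋) ∧
    (u * u' < 0 → 0 < theta (u * u') q) := by
  have hx : u * u' ≠ 0 := mul_ne_zero hu hu'
  rcases lt_or_gt_of_ne (abs_pos.1 hq0) with hq | hq
  · obtain ⟨hu0, hu0'⟩ := hqneg hq
    have hp := mul_pos hu0 hu0'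
    refine ⟨fun _ hk => ?_, fun h => absurd h (not_lt.2 hp.le)⟩
    rw [if_neg (not_lt.2 hq.le)] at hβ hβ'
    refine theta_sign q (q ^ 2) (u * u') _ (sq_pos_of_neg hq)
      (by rwa [sq_lt_one_iff_abs_lt_one]) hp
      (fun y n => tprod_sign_neg q y hq hq1 n) ?_ hk
    rw [hβ, hβ', Real.log_mul hu hu', Real.log_pow, ← Real.log_abs q, ← add_div]
    norm_num
  · have hq1' : q < 1 := lt_of_le_of_lt (le_abs_self q) hq1
    rw [if_pos hq] at hβ hβ'
    refine ⟨fun hp hk => ?_, fun hn => ?_⟩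
    · refine theta_sign q q (u * u') _ hq hq1' hp (fun y n => tprod_sign_pos q y hq hq1' n) ?_ hk
      rw [hβ, hβ', Real.log_mul hu hu', Real.log_abs, Real.log_abs, ← add_div]
    · obtain ⟨t, ht, e⟩ := thF_tprod q (u * u') hq1 hx 0 (fun m _ => by
        unfold thF
        have hp := one_sub_pow_pos q hq1 m
        have hqm : 0 < q ^ (m + 1) := by positivity
        have h1 := mul_neg_of_pos_of_neg hqm hn
        have h2 := mul_neg_of_pos_of_neg hqm (inv_lt_zero.2 hn)
        have h4 : 0 < 1 - q ^ (m + 1) * (u * u') := by linarith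
        have h5 : 0 < 1 - q ^ (m + 1) * (u * u')⁻¹ := by linarith
        exact div_pos (mul_pos h4 h5) (by positivity))
      change 0 < (1 - u * u') * ∏' m, thF q (u * u') m
      rw [e, Finset.range_zero, Finset.prod_empty, one_mul]
      exact mul_pos (by linarith) ht
end

section
/- Let m ≥ 2 be an integer, let θ₁ be an irrational real number, and let θ₂,…,θₙ, θ₀ be arbitrary real numbers. Then the n-dimensional integer array S(v₁,…,vₙ) = ⌊v₁θ₁ + v₂θ₂ + ⋯ + vₙθₙ + θ₀⌋ (indexed by integers vᵢ ≥ 1) is uniformly distributed mod m. -/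
/-- An `n`-dimensional array `S` of integers (indexed by `v ∈ ℤⁿ` with entries `≥ 1`)
is uniformly distributed mod `m` if for each `j ∈ {0,…,m−1}`, the proportion of indices
`v` with `1 ≤ vᵢ ≤ Vᵢ` satisfying `S(v) ≡ j (mod m)` tends to `1/m`
as `V₁,…,Vₙ → ∞` jointly. -/
def UniformlyDistributedModM {n : ℕ} (m : ℕ) (S : (Fin n → ℤ) → ℤ) : Prop :=
  ∀ j : ℤ, 0 ≤ j → j < m →
    Filter.Tendsto
      (fun V : Fin n → ℤ =>
        (Nat.card {v : Fin n → ℤ //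
            (∀ i, 1 ≤ v i ∧ v i ≤ V i) ∧ S v % m = j} : ℝ) /
          ∏ i, (V i : ℝ))
      (Filter.pi fun _ : Fin n => Filter.atTop) (nhds (1 / m))

lemma exists_shift (m : ℕ) (hm : 0 < m) (θ : ℝ) (h : Irrational θ) (δ : ℝ) (hδ : 0 < δ) :
    ∃ (t : ℕ) (s : ℤ), 0 ≤ (t:ℝ) * θ - 1 - m * s ∧ (t:ℝ) * θ - 1 - m * s ≤ δ := by
  have : Fact ((0:ℝ) < m) := ⟨by exact_mod_cast hm⟩
  have h1 : Irrational (θ / (m:ℝ)) := h.div_natCast hm.ne'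
  have h2 := AddCircle.denseRange_zsmul_coe_iff.2 h1
  have h3 : DenseRange (fun k : ℕ => k • (θ : AddCircle (m:ℝ))) := by
    exact denseRange_zsmul_iff_nsmul.1 h2
  have h4 : IsOpen ((fun x : ℝ => (x : AddCircle (m:ℝ))) '' Set.Ioo 1 (1+δ)) :=
    QuotientAddGroup.isOpenMap_coe _ isOpen_Ioo
  obtain ⟨t, y, hy, hty⟩ := h3.exists_mem_open h4 ⟨_, 1 + δ/2, ⟨by linarith, by linarith⟩, rfl⟩
  have h5 : ((y : ℝ) : AddCircle (m:ℝ)) = ((t * θ : ℝ) : AddCircle (m:ℝ)) := by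
    have : ((t * θ : ℝ) : AddCircle (m:ℝ)) = t • (θ : AddCircle (m:ℝ)) := by
      rw [← nsmul_eq_mul]; rfl
    rw [this]; exact hty
  rw [eq_comm, ← sub_eq_zero, ← AddCircle.coe_sub, AddCircle.coe_eq_zero_iff] at h5
  obtain ⟨s, hs⟩ := h5
  rw [zsmul_eq_mul] at hs
  refine ⟨t, s, ?_, ?_⟩ <;> linarith [hy.1, hy.2]

noncomputable def chi (m : ℕ) (j z : ℤ) : ℝ := if (m:ℤ) ∣ z - j then 1 else 0

lemma chi_nonneg (m j z) : 0 ≤ chi m j z := by unfold chi; split_ifs <;> norm_num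
lemma chi_le (m j z) : chi m j z ≤ 1 := by unfold chi; split_ifs <;> norm_num

lemma chi_shift (m : ℕ) (j z s : ℤ) : chi m (j+1) (z + 1 + m * s) = chi m j z := by
  unfold chi
  have : z + 1 + m * s - (j+1) = (z - j) + m * s := by ring
  rw [this]
  simp

lemma chi_diff (m : ℕ) (j z e : ℤ) (he : 0 ≤ e) : |chi m j (z+e) - chi m j z| ≤ e := by
  rcases he.eq_or_lt with rfl | h
  · simp
  · have : (1:ℝ) ≤ e := by exact_mod_cast h
    have := chi_nonneg m j z
    have := chi_nonneg m j (z+e)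
    have := chi_le m j z
    have := chi_le m j (z+e)
    rw [abs_le]; constructor <;> linarith

lemma chi_sum (m : ℕ) (hm : 0 < m) (j z : ℤ) : ∑ i ∈ Finset.range m, chi m (j + i) z = 1 := by
  have hm' : (0:ℤ) < m := by exact_mod_cast hm
  have h1 := Int.emod_nonneg (z - j) hm'.ne'
  have h2 := Int.emod_lt_of_pos (z - j) hm'
  rw [Finset.sum_eq_single ((z - j) % m).toNat]
  · unfold chi
    rw [if_pos]
    rw [Int.toNat_of_nonneg h1, ← sub_sub]
    exact Int.dvd_self_sub_emod
  · intro b hb hne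
    unfold chi
    rw [if_neg]
    intro hd
    apply hne
    rw [← sub_sub] at hd
    have h3 := (Int.emod_emod_of_dvd (z-j) (dvd_refl (m:ℤ)))
    have h4 := Int.emod_eq_emod_iff_emod_sub_eq_zero.2 (Int.emod_eq_zero_of_dvd hd)
    rw [Int.emod_eq_of_lt (a := (b:ℤ)) (by omega) (by simpa using hb)] at h4
    omega
  · intro h; exfalso; apply h; simp; omega

lemma sum_shift (f : ℕ → ℝ) (t N : ℕ) :
    ∑ k ∈ Finset.range N, (f (k + t) - f k) = ∑ k ∈ Finset.range t, (f (N + k) - f k) := by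
  have h1 := Finset.sum_range_add f N t
  have h2 := Finset.sum_range_add f t N
  rw [add_comm t N, h1] at h2
  simp only [Finset.sum_sub_distrib]
  simp only [add_comm _ t]
  linarith

lemma key (m : ℕ) (θ x : ℝ) (t : ℕ) (s : ℤ) (δ : ℝ) (h0 : 0 ≤ (t:ℝ) * θ - 1 - m * s)
    (h1 : (t:ℝ) * θ - 1 - m * s ≤ δ) (N : ℕ) (j : ℤ) :
    |∑ k ∈ Finset.range N, chi m (j+1) ⌊(k:ℝ) * θ + x⌋
      - ∑ k ∈ Finset.range N, chi m j ⌊(k:ℝ) * θ + x⌋| ≤ N * δ + 2 * t := by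
  set g : ℕ → ℤ := fun k => ⌊(k:ℝ) * θ + x⌋ with hg
  set e : ℕ → ℤ := fun k => g (k+t) - g k - 1 - m * s with he
  have he0 : ∀ k, 0 ≤ e k := by
    intro k
    have : g k + (1 + m * s) ≤ g (k+t) := by
      simp only [hg]
      rw [← Int.floor_add_intCast]
      apply Int.floor_le_floor
      push_cast
      linarith
    simp only [he]; linarith
  have hes : ∑ k ∈ Finset.range N, (e k : ℝ) ≤ N * δ + t := by
    have a1 : ∑ k ∈ Finset.range N, (e k : ℝ)
        = ∑ k ∈ Finset.range N, ((g (k+t) : ℝ) - g k) - N * (1 + m * s) := by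
      simp only [he]
      push_cast
      simp only [Finset.sum_sub_distrib, Finset.sum_const, Finset.card_range, nsmul_eq_mul]
      ring
    have a2 : ∑ k ∈ Finset.range t, ((g (N+k) : ℝ) - g k) ≤ ∑ k ∈ Finset.range t, (N * θ + 1) := by
      apply Finset.sum_le_sum
      intro k _
      have b1 := Int.floor_le (((N + k : ℕ) : ℝ) * θ + x)
      have b2 := Int.lt_floor_add_one ((k : ℝ) * θ + x)
      simp only [hg]
      push_cast at b1 ⊢
      linarith
    rw [a1, sum_shift (fun k => (g k : ℝ))]
    simp only [Finset.sum_const, Finset.card_range, nsmul_eq_mul] at a2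
    have : (N:ℝ) * ((t:ℝ) * θ - 1 - m * s) ≤ N * δ := by gcongr
    linarith
  have c1 : |∑ k ∈ Finset.range N, (chi m (j+1) (g (k+t)) - chi m j (g k))| ≤ N * δ + t := by
    refine le_trans (Finset.abs_sum_le_sum_abs _ _) (le_trans (Finset.sum_le_sum ?_) hes)
    intro k _
    have : g (k+t) = (g k + e k) + 1 + m * s := by simp only [he]; ring
    rw [this, chi_shift]
    exact chi_diff m j _ _ (he0 k)
  have c2 : |∑ k ∈ Finset.range N, (chi m (j+1) (g (k+t)) - chi m (j+1) (g k))| ≤ t := by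
    rw [sum_shift (fun k => chi m (j+1) (g k))]
    refine le_trans (Finset.abs_sum_le_sum_abs _ _) (le_trans (Finset.sum_le_sum (g := fun _ => (1:ℝ)) ?_) ?_)
    · intro k _
      rw [abs_le]
      have := chi_nonneg m (j+1) (g k)
      have := chi_nonneg m (j+1) (g (N+k))
      have := chi_le m (j+1) (g k)
      have := chi_le m (j+1) (g (N+k))
      constructor <;> linarith
    · simp
  simp only [Finset.sum_sub_distrib] at c1 c2
  rw [abs_le] at *
  constructor <;> linarith [c1.1, c1.2, c2.1, c2.2]

lemma unif (m : ℕ) (hm : 0 < m) (θ : ℝ) (h : Irrational θ) (ε : ℝ) (hε : 0 < ε) :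
    ∃ C : ℝ, ∀ (N : ℕ) (x : ℝ) (j : ℤ),
      |∑ k ∈ Finset.range N, chi m j ⌊(k:ℝ) * θ + x⌋ - N / m| ≤ N * ε + C := by
  have hm' : (0:ℝ) < m := by exact_mod_cast hm
  obtain ⟨t, s, h0, h1⟩ := exists_shift m hm θ h (ε / m) (by positivity)
  refine ⟨m * (2 * t), fun N x j => ?_⟩
  set S : ℤ → ℝ := fun j => ∑ k ∈ Finset.range N, chi m j ⌊(k:ℝ) * θ + x⌋ with hS
  have hk : ∀ j, |S (j+1) - S j| ≤ N * (ε / m) + 2 * t := key m θ x t s _ h0 h1 N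
  have hi : ∀ i : ℕ, |S (j+i) - S j| ≤ i * (N * (ε / m) + 2 * t) := by
    intro i
    induction i with
    | zero => simp
    | succ i ih =>
      have := hk (j+i)
      push_cast
      rw [← add_assoc]
      calc _ ≤ _ := abs_sub_le _ (S (j+i)) _
        _ ≤ _ := by linarith
  have hsum : ∑ i ∈ Finset.range m, S (j + i) = N := by
    simp only [hS]
    rw [Finset.sum_comm]
    simp [chi_sum m hm]
  have hb : |∑ i ∈ Finset.range m, (S (j+i) - S j)| ≤ m * (m * (N * (ε / m) + 2 * t)) := by
    refine le_trans (Finset.abs_sum_le_sum_abs _ _) ?_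
    calc _ ≤ ∑ i ∈ Finset.range m, (m:ℝ) * (N * (ε / m) + 2 * t) := by
          apply Finset.sum_le_sum
          intro i hi'
          refine (hi i).trans ?_
          have : (i:ℝ) ≤ m := by exact_mod_cast (Finset.mem_range.1 hi').le
          gcongr
      _ = _ := by simp
  rw [Finset.sum_sub_distrib, hsum] at hb
  simp only [Finset.sum_const, Finset.card_range, nsmul_eq_mul] at hb
  have e1 : S j - N / m = -((N - m * S j) / m) := by field_simp; ring
  change |S j - N / m| ≤ _
  rw [e1, abs_neg, abs_div, abs_of_pos hm', div_le_iff₀ hm']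
  refine hb.trans (le_of_eq ?_)
  field_simp

lemma card_eq (m : ℕ) (n : ℕ) (θ : Fin (n+1) → ℝ) (θ₀ : ℝ) (V : Fin (n+1) → ℤ) (j : ℤ)
    (hj0 : 0 ≤ j) (hjm : j < m) (N : ℕ) (hN : V 0 = N) :
    (Nat.card {v : Fin (n+1) → ℤ //
            (∀ i, 1 ≤ v i ∧ v i ≤ V i) ∧ ⌊(∑ i, (v i : ℝ) * θ i) + θ₀⌋ % m = j} : ℝ)
    = ∑ w ∈ Fintype.piFinset (fun i : Fin n => Finset.Icc 1 (V i.succ)),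
        ∑ k ∈ Finset.range N,
          chi m j ⌊(k:ℝ) * θ 0 + (θ 0 + ∑ i, (w i : ℝ) * θ i.succ + θ₀)⌋ := by
  classical
  have h1 : Nat.card {v : Fin (n+1) → ℤ //
            (∀ i, 1 ≤ v i ∧ v i ≤ V i) ∧ ⌊(∑ i, (v i : ℝ) * θ i) + θ₀⌋ % m = j}
      = ((Fintype.piFinset (fun i => Finset.Icc 1 (V i))).filter
          (fun v => ⌊(∑ i, (v i : ℝ) * θ i) + θ₀⌋ % m = j)).card := by
    rw [← Nat.card_eq_finsetCard]
    refine Nat.card_congr (Equiv.subtypeEquivRight fun v => ?_)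
    simp [Fintype.mem_piFinset]
  have hchi : ∀ z : ℤ, chi m j z = if z % m = j then 1 else 0 := by
    intro z
    unfold chi
    have : (m:ℤ) ∣ z - j ↔ z % m = j := by
      rw [← Int.emod_eq_emod_iff_emod_sub_eq_zero.trans Int.dvd_iff_emod_eq_zero.symm,
        Int.emod_eq_of_lt hj0 hjm]
    simp only [this]
  rw [h1, Finset.card_filter]
  push_cast
  rw [← Finset.sum_product']
  symm
  refine Finset.sum_bij' (fun p _ => (Fin.cons ((p.2:ℤ)+1) p.1 : Fin (n+1) → ℤ))
    (fun v _ => (Fin.tail v, (v 0 - 1).toNat)) ?_ ?_ ?_ ?_ ?_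
  · rintro ⟨w, k⟩ h
    simp only [Finset.mem_product, Fintype.mem_piFinset, Finset.mem_Icc, Finset.mem_range] at h ⊢
    intro i
    refine Fin.cases ?_ (fun i => ?_) i
    · simp only [Fin.cons_zero]; omega
    · simpa using h.1 i
  · intro v h
    simp only [Finset.mem_product, Fintype.mem_piFinset, Finset.mem_Icc, Finset.mem_range] at h ⊢
    refine ⟨fun i => h i.succ, ?_⟩
    have := h 0
    omega
  · rintro ⟨w, k⟩ h
    simp
  · intro v h
    simp only [Fintype.mem_piFinset, Finset.mem_Icc] at h
    have := h 0
    have e : (((v 0 - 1).toNat : ℤ)) + 1 = v 0 := by omega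
    simp only [e, Fin.cons_self_tail]
  · rintro ⟨w, k⟩ h
    simp only [hchi, Fin.sum_univ_succ, Fin.cons_zero, Fin.cons_succ]
    have : (k:ℝ) * θ 0 + (θ 0 + ∑ i, (w i : ℝ) * θ i.succ + θ₀)
      = (((k:ℤ) + 1 : ℤ) : ℝ) * θ 0 + ∑ i, (w i : ℝ) * θ i.succ + θ₀ := by push_cast; ring
    rw [this]

/-- If `m ≥ 2`, `θ₁` is irrational and `θ₂,…,θₙ,θ₀` are arbitrary real numbers, then the
integer array `S(v) = ⌊v₁θ₁ + ⋯ + vₙθₙ + θ₀⌋` is uniformly distributed mod `m`. -/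
theorem floor_linear_array_ud_mod_m (m : ℕ) (hm : 2 ≤ m)
    (n : ℕ) (hn : 1 ≤ n) (θ : Fin n → ℝ) (θ₀ : ℝ)
    (hirr : Irrational (θ ⟨0, hn⟩)) :
    UniformlyDistributedModM m
      (fun v : Fin n → ℤ => ⌊(∑ i, (v i : ℝ) * θ i) + θ₀⌋) := by
  obtain ⟨n, rfl⟩ : ∃ n', n = n' + 1 := ⟨n - 1, by omega⟩
  intro j hj0 hjm
  rw [Metric.tendsto_nhds]
  intro ε hε
  obtain ⟨C, hC⟩ := unif m (by omega) (θ 0) hirr (ε/2) (by positivity)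
  have hev : ∀ i : Fin (n+1), ∀ K : ℤ, ∀ᶠ V : Fin (n+1) → ℤ in
      Filter.pi fun _ : Fin (n+1) => Filter.atTop, K ≤ V i := fun i K =>
    (Filter.tendsto_eval_pi (fun _ : Fin (n+1) => (Filter.atTop : Filter ℤ)) i).eventually
      (Filter.eventually_ge_atTop K)
  have hpos : ∀ᶠ V : Fin (n+1) → ℤ in
      Filter.pi fun _ : Fin (n+1) => Filter.atTop, ∀ i, 1 ≤ V i :=
    Filter.eventually_all.2 fun i => hev i 1
  filter_upwards [hpos, hev 0 (⌈2 * C / ε⌉ + 1)] with V hV hV0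
  obtain ⟨N, hN⟩ := Int.eq_ofNat_of_zero_le (zero_le_one.trans (hV 0))
  rw [card_eq m n θ θ₀ V j hj0 hjm N hN, Real.dist_eq, Fin.prod_univ_succ, hN]
  have hP : (0:ℝ) < ∏ i : Fin n, (V i.succ : ℝ) :=
    Finset.prod_pos fun i _ => by exact_mod_cast hV i.succ
  have hNpos : (0:ℝ) < N := by
    have := hV 0
    have : 0 < N := by omega
    exact_mod_cast this
  have hNC : C < N * (ε / 2) := by
    have a1 : ((⌈2 * C / ε⌉ + 1 : ℤ) : ℝ) ≤ N := by
      rw [hN] at hV0; exact_mod_cast hV0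
    have a2 := Int.le_ceil (2 * C / ε)
    push_cast at a1
    have a3 : 2 * C / ε < N := by linarith
    rw [div_lt_iff₀ hε] at a3
    linarith
  set B := Fintype.piFinset (fun i : Fin n => Finset.Icc 1 (V i.succ)) with hB
  have hBc : (B.card : ℝ) = ∏ i : Fin n, (V i.succ : ℝ) := by
    rw [hB, Fintype.card_piFinset]
    push_cast
    refine Finset.prod_congr rfl fun i _ => ?_
    rw [Int.card_Icc]
    have := hV i.succ
    have e : (((V i.succ + 1 - 1).toNat : ℤ)) = V i.succ := by omega
    exact_mod_cast congrArg (Int.cast : ℤ → ℝ) e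
  rw [← hBc] at hP ⊢
  set T := ∑ w ∈ B, ∑ k ∈ Finset.range N,
          chi m j ⌊(k:ℝ) * θ 0 + (θ 0 + ∑ i, (w i : ℝ) * θ i.succ + θ₀)⌋ with hT
  have hTb : |T - B.card * (N / m)| ≤ B.card * (N * (ε/2) + C) := by
    have e : T - B.card * (N / m) = ∑ w ∈ B, (∑ k ∈ Finset.range N,
          chi m j ⌊(k:ℝ) * θ 0 + (θ 0 + ∑ i, (w i : ℝ) * θ i.succ + θ₀)⌋ - N / m) := by
      rw [Finset.sum_sub_distrib]; simp [hT]
    rw [e]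
    refine le_trans (Finset.abs_sum_le_sum_abs _ _) ?_
    refine (Finset.sum_le_sum fun w _ => hC N _ j).trans (le_of_eq ?_)
    rw [Finset.sum_const, nsmul_eq_mul]
  have hm' : (0:ℝ) < m := by exact_mod_cast (by omega : 0 < m)
  have e2 : T / (((N : ℤ) : ℝ) * B.card) - 1 / m = (T - B.card * (N / m)) / (N * B.card) := by
    push_cast
    field_simp
  change |T / (((N : ℤ) : ℝ) * B.card) - 1 / m| < ε
  have hNB : (0:ℝ) < N * B.card := by positivity
  rw [e2, abs_div, abs_of_pos hNB, div_lt_iff₀ hNB]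
  refine hTb.trans_lt ?_
  have := mul_lt_mul_of_pos_left (by linarith : N * (ε/2) + C < N * ε) hP
  linarith
end

section
/- Let n ≥ 1 and let β₁,…,βₙ be real numbers such that 1, β₁,…,βₙ are linearly independent over ℚ. Then the n-dimensional integer array S(v₁,…,vₙ) = ⌊Σ_{i=1}^{n} vᵢβᵢ⌋ + Σ_{1≤i<j≤n} ⌊βᵢ+βⱼ⌋·vᵢvⱼ (indexed by integers vᵢ ≥ 1) is uniformly distributed mod 2. -/
open Finset

noncomputable def sgn2 (z : ℤ) : ℝ := if Even z then 1 else -1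

lemma sgn2_add (a b : ℤ) : sgn2 (a + b) = sgn2 a * sgn2 b := by
  unfold sgn2
  by_cases ha : Even a <;> by_cases hb : Even b <;> simp [Int.even_add, ha, hb]

lemma sgn2_abs (a : ℤ) : |sgn2 a| = 1 := by
  unfold sgn2
  by_cases ha : Even a <;> simp [ha]

lemma sgn2_flip (a l : ℤ) : sgn2 (a + (1 + 2 * l)) = - sgn2 a := by
  unfold sgn2
  by_cases ha : Even a <;> simp [Int.even_add, ha]

lemma exists_gap (γ : ℝ) (hγ : Irrational γ) (Q : ℕ) :
    ∃ δ : ℝ, 0 < δ ∧ ∀ j : ℕ, 1 ≤ j → j < Q → ∀ m : ℤ, 2 * δ < |(j : ℝ) * γ - m| := by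
  induction Q with
  | zero => exact ⟨1, one_pos, fun j _ h => absurd h (by omega)⟩
  | succ Q ih =>
    obtain ⟨δ, hδ, h⟩ := ih
    rcases Nat.eq_zero_or_pos Q with h0 | hQ
    · exact ⟨1, one_pos, fun j h1 h2 => absurd h2 (by omega)⟩
    have hirr : Irrational ((Q : ℝ) * γ) := by
      exact hγ.natCast_mul (by omega)
    have hpos : 0 < |(Q : ℝ) * γ - round ((Q : ℝ) * γ)| := by
      rw [abs_pos, sub_ne_zero]
      exact hirr.ne_int _
    refine ⟨min δ (|(Q : ℝ) * γ - round ((Q : ℝ) * γ)| / 3), by positivity, ?_⟩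
    intro j h1 h2 m
    rcases Nat.lt_or_ge j Q with h3 | h3
    · have := h j h1 h3 m
      have := min_le_left δ (|(Q : ℝ) * γ - round ((Q : ℝ) * γ)| / 3)
      linarith
    · have : j = Q := by omega
      subst this
      have := min_le_right δ (|(j : ℝ) * γ - round ((j : ℝ) * γ)| / 3)
      have := round_le ((j : ℝ) * γ) m
      linarith

lemma exists_shift_s16 (γ : ℝ) (hγ : Irrational γ) (ε : ℝ) (hε : 0 < ε) :
    ∃ (k : ℕ) (l : ℤ), |(k : ℝ) * γ - (1 + 2 * l)| < ε := by
  have hd : Dense ((AddSubgroup.closure {γ, (2 : ℝ)} : AddSubgroup ℝ) : Set ℝ) := by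
    rw [dense_addSubgroupClosure_pair_iff]
    exact hγ.div_natCast (m := 2) (by norm_num)
  obtain ⟨y, hy, hy2⟩ := hd.exists_dist_lt 1 hε
  rw [SetLike.mem_coe, AddSubgroup.mem_closure_pair] at hy
  obtain ⟨a, b, rfl⟩ := hy
  rw [Real.dist_eq] at hy2
  simp only [zsmul_eq_mul] at hy2
  obtain ⟨k, rfl | rfl⟩ := Int.eq_nat_or_neg a
  · refine ⟨k, -b, ?_⟩
    rw [abs_sub_comm] at hy2
    convert hy2 using 2
    push_cast; ring
  · refine ⟨k, b - 1, ?_⟩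
    convert hy2 using 2
    push_cast; ring

lemma floor_flip (x d δ : ℝ) (hd : |d| < δ) (h : ⌊x + d⌋ ≠ ⌊x⌋) : ∃ m : ℤ, |x - m| < δ := by
  rw [abs_lt] at hd
  have h1 := Int.floor_le x
  have h2 := Int.lt_floor_add_one x
  have h3 := Int.floor_le (x + d)
  have h4 := Int.lt_floor_add_one (x + d)
  rcases lt_or_gt_of_ne h with h | h
  · refine ⟨⌊x⌋, ?_⟩
    have : ((⌊x + d⌋ : ℤ) : ℝ) + 1 ≤ ⌊x⌋ := by exact_mod_cast h
    rw [abs_lt]; constructor <;> linarith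
  · refine ⟨⌊x + d⌋, ?_⟩
    have : ((⌊x⌋ : ℤ) : ℝ) + 1 ≤ ⌊x + d⌋ := by exact_mod_cast h
    rw [abs_lt]; constructor <;> linarith

lemma card_sep (Q N : ℕ) (hQ : 0 < Q) (B : Finset ℕ) (hB : B ⊆ range N)
    (hs : ∀ v ∈ B, ∀ w ∈ B, v < w → Q ≤ w - v) : B.card ≤ N / Q + 1 := by
  have : B.card ≤ (range (N / Q + 1)).card := by
    refine Finset.card_le_card_of_injOn (fun v => v / Q) ?_ ?_
    · intro v hv
      have := hB hv
      simp only [coe_range, Set.mem_Iio, mem_range] at *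
      exact Nat.lt_succ_of_le (Nat.div_le_div_right this.le)
    · have key : ∀ v ∈ B, ∀ w ∈ B, v < w → v / Q ≠ w / Q := by
        intro v hv w hw hlt he
        have := hs v hv w hw hlt
        have : v + Q ≤ w := by omega
        have h2 := Nat.div_le_div_right (c := Q) this
        rw [Nat.add_div_right _ hQ] at h2
        omega
      intro v hv w hw he
      rcases lt_trichotomy v w with h | h | h
      · exact absurd he (key v hv w hw h)
      · exact h
      · exact absurd he.symm (key w hw v hv h)
  simpa using this

lemma sum_shift_bound (f : ℕ → ℝ) (hf : ∀ i, |f i| ≤ 1) (N k : ℕ) :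
    |∑ i ∈ range N, f (i + k) - ∑ i ∈ range N, f i| ≤ 2 * k := by
  induction k with
  | zero => simp
  | succ k ih =>
    have h1 : ∑ i ∈ range N, f (i + (k + 1)) = ∑ i ∈ range N, f (i + k) + f (N + k) - f (0 + k) := by
      have a := Finset.sum_range_succ (fun i => f (i + k)) N
      have b := Finset.sum_range_succ' (fun i => f (i + k)) N
      have c : ∀ i, f (i + 1 + k) = f (i + (k + 1)) := fun i => by congr 1; ring
      simp only [c] at b
      linarith
    rw [h1]
    have h2 := abs_le.1 (hf (N + k))
    have h3 := abs_le.1 (hf (0 + k))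
    rw [abs_le] at ih ⊢
    push_cast
    constructor <;> linarith

lemma one_dim (γ : ℝ) (hγ : Irrational γ) (ε : ℝ) (hε : 0 < ε) :
    ∃ N₀ : ℕ, ∀ N : ℕ, N₀ ≤ N → ∀ θ : ℝ,
      |∑ i ∈ range N, sgn2 ⌊(i : ℝ) * γ + θ⌋| ≤ ε * N := by
  obtain ⟨Q, hQ⟩ := exists_nat_gt (2 / ε)
  have hQ0 : (0 : ℝ) < Q := lt_trans (by positivity) hQ
  have hQ0' : 0 < Q := by exact_mod_cast hQ0
  obtain ⟨δ, hδ, hgap⟩ := exists_gap γ hγ Q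
  obtain ⟨k, l, hk⟩ := exists_shift_s16 γ hγ δ hδ
  obtain ⟨N₀, hN₀⟩ := exists_nat_gt (2 * (1 + (k : ℝ)) / ε)
  refine ⟨N₀, fun N hN θ => ?_⟩
  classical
  set f : ℕ → ℝ := fun i => sgn2 ⌊(i : ℝ) * γ + θ⌋ with hf
  set B := (range N).filter (fun i => f i + f (i + k) ≠ 0) with hB
  have hfa : ∀ i, |f i| ≤ 1 := fun i => (sgn2_abs _).le
  have hbad : ∀ i, f i + f (i + k) ≠ 0 → ∃ m : ℤ, |(i : ℝ) * γ + θ - m| < δ := by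
    intro i hi
    refine floor_flip _ _ δ hk ?_
    intro heq
    apply hi
    have : ⌊((i + k : ℕ) : ℝ) * γ + θ⌋ = ⌊(i : ℝ) * γ + θ⌋ + (1 + 2 * l) := by
      rw [← heq, ← Int.floor_add_intCast]
      congr 1
      push_cast; ring
    simp only [hf]
    rw [this, sgn2_flip]; ring
  have hcard : B.card ≤ N / Q + 1 := by
    refine card_sep Q N hQ0' B (filter_subset _ _) ?_
    intro v hv w hw hlt
    by_contra hcon
    obtain ⟨m, hm⟩ := hbad v (mem_filter.1 hv).2
    obtain ⟨m', hm'⟩ := hbad w (mem_filter.1 hw).2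
    have := hgap (w - v) (by omega) (by omega) (m' - m)
    rw [Nat.cast_sub hlt.le] at this
    have e : ((w : ℝ) - v) * γ - ((m' - m : ℤ) : ℝ) = (w * γ + θ - m') - (v * γ + θ - m) := by
      push_cast; ring
    rw [e] at this
    have := abs_sub (w * γ + θ - m') (v * γ + θ - m)
    linarith
  have hcard' : (B.card : ℝ) ≤ N / Q + 1 := by
    have h1 : (B.card : ℝ) ≤ ((N / Q : ℕ) : ℝ) + 1 := by exact_mod_cast hcard
    have := @Nat.cast_div_le ℝ _ _ _ N Q
    linarith
  have hsum : |∑ i ∈ range N, (f i + f (i + k))| ≤ 2 * B.card := by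
    have : ∑ i ∈ range N, (f i + f (i + k)) = ∑ i ∈ B, (f i + f (i + k)) := by
      rw [hB, Finset.sum_filter_ne_zero]
    rw [this]
    refine (Finset.abs_sum_le_sum_abs _ _).trans ?_
    have := Finset.sum_le_card_nsmul B (fun i => |f i + f (i + k)|) 2 (fun i _ =>
      (abs_add_le _ _).trans (by linarith [hfa i, hfa (i + k)]))
    rw [nsmul_eq_mul] at this
    linarith
  have hsh := sum_shift_bound f hfa N k
  rw [Finset.sum_add_distrib] at hsum
  have hNQ : (N : ℝ) / Q ≤ ε / 2 * N := by
    rw [div_le_iff₀ hQ0]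
    rw [div_lt_iff₀ hε] at hQ
    have hN0 : (0 : ℝ) ≤ N := Nat.cast_nonneg N
    nlinarith
  have hNk : 1 + (k : ℝ) ≤ ε / 2 * N := by
    have : (N₀ : ℝ) ≤ N := by exact_mod_cast hN
    rw [div_lt_iff₀ hε] at hN₀
    nlinarith
  rw [abs_le] at hsum hsh ⊢
  constructor <;> linarith

lemma sum_Icc_int (f : ℤ → ℝ) (N : ℕ) :
    ∑ v ∈ Icc (1 : ℤ) N, f v = ∑ i ∈ range N, f (i + 1) := by
  symm
  refine Finset.sum_bij' (fun i _ => (i : ℤ) + 1) (fun v _ => (v - 1).toNat) ?_ ?_ ?_ ?_ ?_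
  · intro i hi; simp at *; omega
  · intro i hi; simp at *; omega
  · intro i hi; simp
  · intro i hi; simp at *; omega
  · intro i hi; rfl

lemma one_dim' (γ : ℝ) (hγ : Irrational γ) (ε : ℝ) (hε : 0 < ε) :
    ∃ M₀ : ℤ, 1 ≤ M₀ ∧ ∀ M : ℤ, M₀ ≤ M → ∀ (θ : ℝ) (A C : ℤ),
      |∑ v ∈ Icc (1 : ℤ) M, sgn2 (⌊(v : ℝ) * γ + θ⌋ + v * A + C)| ≤ ε * M := by
  obtain ⟨N₀, h0⟩ := one_dim γ hγ ε hε
  obtain ⟨N₁, h1⟩ := one_dim (γ + (1 : ℤ)) (hγ.add_intCast 1) ε hε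
  refine ⟨max 1 (max N₀ N₁ : ℤ), le_max_left _ _, fun M hM θ A C => ?_⟩
  obtain ⟨N, rfl⟩ := Int.eq_ofNat_of_zero_le (show 0 ≤ M by
    have := le_max_left 1 (max N₀ N₁ : ℤ); omega)
  have hN0 : N₀ ≤ N := by simp at hM; omega
  have hN1 : N₁ ≤ N := by simp at hM; omega
  rw [sum_Icc_int]
  simp only [sgn2_add _ C]
  rw [← Finset.sum_mul, abs_mul, sgn2_abs, mul_one]
  rcases Int.even_or_odd A with hA | hA
  · have h := h0 N hN0 (γ + θ)
    rw [Int.cast_natCast]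
    refine (le_of_eq (congrArg _ (Finset.sum_congr rfl fun i hi => ?_))).trans h
    push_cast
    rw [sgn2_add, show ((i : ℝ) + 1) * γ + θ = i * γ + (γ + θ) by ring]
    have : sgn2 (((i : ℤ) + 1) * A) = 1 := by
      unfold sgn2; simp [Int.even_mul, hA]
    rw [this, mul_one]
  · have h := h1 N hN1 (γ + (1 : ℤ) + θ)
    rw [Int.cast_natCast]
    refine (le_of_eq (congrArg _ (Finset.sum_congr rfl fun i hi => ?_))).trans h
    rw [sgn2_add, show (i : ℝ) * (γ + (1 : ℤ)) + (γ + (1 : ℤ) + θ) =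
      ((((i : ℤ) + 1 : ℤ) : ℝ) * γ + θ) + (((i : ℤ) + 1 : ℤ) : ℝ) by push_cast; ring]
    rw [Int.floor_add_intCast, sgn2_add]
    congr 1
    unfold sgn2
    have : ¬ Even A := by simpa using hA
    simp [Int.even_mul, this]

lemma sum_box {n : ℕ} (V : Fin (n + 1) → ℤ) (F : (Fin (n + 1) → ℤ) → ℝ) :
    ∑ v ∈ Fintype.piFinset (fun i => Icc (1 : ℤ) (V i)), F v =
      ∑ w ∈ Fintype.piFinset (fun i : Fin n => Icc (1 : ℤ) (V i.succ)),
        ∑ a ∈ Icc (1 : ℤ) (V 0), F (Fin.cons a w) := by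
  rw [← Finset.sum_product']
  refine Finset.sum_bij' (fun v _ => (Fin.tail v, v 0)) (fun p _ => Fin.cons p.2 p.1)
    ?_ ?_ ?_ ?_ ?_
  · intro v hv
    rw [Fintype.mem_piFinset] at hv
    simp only [mem_product, Fintype.mem_piFinset]
    exact ⟨fun i => hv i.succ, hv 0⟩
  · intro p hp
    simp only [mem_product, Fintype.mem_piFinset] at hp
    rw [Fintype.mem_piFinset]
    intro i
    refine Fin.cases ?_ (fun j => ?_) i
    · exact hp.2
    · exact hp.1 j
  · intro v hv; exact Fin.cons_self_tail v
  · intro p hp; simp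
  · intro v hv; simp [Fin.cons_self_tail]

lemma box_bound {n : ℕ} (β : Fin (n + 1) → ℝ) (hβ : Irrational (β 0)) (ε : ℝ) (hε : 0 < ε) :
    ∃ M₀ : ℤ, 1 ≤ M₀ ∧ ∀ V : Fin (n + 1) → ℤ, (∀ i, M₀ ≤ V i) →
      |∑ v ∈ Fintype.piFinset (fun i => Icc (1 : ℤ) (V i)),
        sgn2 (⌊∑ i, (v i : ℝ) * β i⌋ +
          ∑ i : Fin (n + 1), ∑ j : Fin (n + 1),
            if i < j then ⌊β i + β j⌋ * v i * v j else 0)| ≤ ε * ∏ i, (V i : ℝ) := by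
  obtain ⟨M₀, hM1, hM⟩ := one_dim' (β 0) hβ ε hε
  refine ⟨M₀, hM1, fun V hV => ?_⟩
  rw [sum_box]
  refine (Finset.abs_sum_le_sum_abs _ _).trans ?_
  refine (Finset.sum_le_card_nsmul _ _ (ε * V 0) ?_).trans ?_
  · intro w hw
    have h := hM (V 0) (hV 0) (∑ i : Fin n, (w i : ℝ) * β i.succ)
      (∑ j : Fin n, ⌊β 0 + β j.succ⌋ * w j)
      (∑ i : Fin n, ∑ j : Fin n, if i < j then ⌊β i.succ + β j.succ⌋ * w i * w j else 0)
    refine (le_of_eq (congrArg _ (Finset.sum_congr rfl fun a ha => congrArg _ ?_))).trans h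
    simp only [Fin.sum_univ_succ, Fin.cons_zero, Fin.cons_succ, Fin.succ_lt_succ_iff,
      Fin.succ_pos, if_true, lt_irrefl, if_false, Fin.not_lt_zero, zero_add, add_assoc]
    congr 2
    rw [Finset.mul_sum]
    exact Finset.sum_congr rfl fun j _ => by ring
  · rw [nsmul_eq_mul, Fintype.card_piFinset, Fin.prod_univ_succ]
    have : ∀ i : Fin n, (((Icc (1 : ℤ) (V i.succ)).card : ℕ) : ℝ) = V i.succ := by
      intro i
      have h := hV i.succ
      rw [Int.card_Icc]
      have : (((V i.succ + 1 - 1).toNat : ℤ)) = V i.succ := by omega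
      exact_mod_cast this
    push_cast
    simp only [this]
    apply le_of_eq; ring

lemma count_eq {n : ℕ} (S : (Fin n → ℤ) → ℤ) (V : Fin n → ℤ) (hV : ∀ i, 1 ≤ V i) (j : ℤ)
    (hj : j = 0 ∨ j = 1) :
    (Nat.card {v : Fin n → ℤ // (∀ i, 1 ≤ v i ∧ v i ≤ V i) ∧ S v % (2 : ℕ) = j} : ℝ) =
      (∏ i, (V i : ℝ) + sgn2 j *
        ∑ v ∈ Fintype.piFinset (fun i => Icc (1 : ℤ) (V i)), sgn2 (S v)) / 2 := by
  classical
  have h1 : Nat.card {v : Fin n → ℤ // (∀ i, 1 ≤ v i ∧ v i ≤ V i) ∧ S v % (2 : ℕ) = j} =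
      ((Fintype.piFinset (fun i => Icc (1 : ℤ) (V i))).filter (fun v => S v % 2 = j)).card := by
    refine Nat.subtype_card _ ?_
    intro v
    simp [Fintype.mem_piFinset]
  have h2 : ∏ i, (V i : ℝ) = ∑ v ∈ Fintype.piFinset (fun i => Icc (1 : ℤ) (V i)), (1 : ℝ) := by
    rw [Finset.sum_const, nsmul_eq_mul, mul_one, Fintype.card_piFinset]
    push_cast
    refine Finset.prod_congr rfl fun i _ => ?_
    rw [Int.card_Icc]
    have := hV i
    have : (((V i + 1 - 1).toNat : ℤ)) = V i := by omega
    exact_mod_cast this.symm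
  rw [h1, h2, Finset.card_filter, Finset.mul_sum, ← Finset.sum_add_distrib, Finset.sum_div]
  push_cast
  refine Finset.sum_congr rfl fun v _ => ?_
  unfold sgn2
  rcases hj with rfl | rfl <;> rcases Int.emod_two_eq_zero_or_one (S v) with h | h <;>
    simp [Int.even_iff, h]

/-- If `1, β₁,…,βₙ` are linearly independent over `ℚ`, then the integer array
`S(v) = ⌊Σᵢ vᵢβᵢ⌋ + Σ_{i<j} ⌊βᵢ+βⱼ⌋·vᵢvⱼ` is uniformly distributed mod 2. -/
theorem sign_array_ud_mod_two (n : ℕ) (hn : 1 ≤ n) (β : Fin n → ℝ)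
    (hind : ∀ (c₀ : ℤ) (c : Fin n → ℤ),
      (c₀ : ℝ) + ∑ i, (c i : ℝ) * β i = 0 → c₀ = 0 ∧ ∀ i, c i = 0) :
    UniformlyDistributedModM 2
      (fun v : Fin n → ℤ =>
        ⌊∑ i, (v i : ℝ) * β i⌋ +
          ∑ i : Fin n, ∑ j : Fin n,
            if i < j then ⌊β i + β j⌋ * v i * v j else 0) := by
  obtain ⟨n, rfl⟩ : ∃ k, n = k + 1 := ⟨n - 1, by omega⟩
  have hβ : Irrational (β 0) := by
    rintro ⟨q, hq⟩
    have h := (hind (-q.num) (fun i => if i = 0 then q.den else 0) (by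
      simp only [Int.cast_ite, ite_mul, Int.cast_zero, zero_mul, Finset.sum_ite_eq', mem_univ,
        if_true]
      rw [← hq]
      have : ((q.den : ℝ)) * (q : ℝ) = q.num := by
        exact_mod_cast q.den_mul_eq_num
      push_cast
      linarith)).2 0
    simp at h
  intro j hj0 hj2
  have hj : j = 0 ∨ j = 1 := by
    push_cast at hj2
    omega
  rw [Metric.tendsto_nhds]
  intro ε hε
  obtain ⟨M₀, hM1, hM⟩ := box_bound β hβ ε hε
  have hev : ∀ᶠ V : Fin (n + 1) → ℤ in Filter.pi (fun _ => Filter.atTop), ∀ i, M₀ ≤ V i := by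
    rw [Filter.eventually_all]
    intro i
    exact (Filter.tendsto_eval_pi (fun _ : Fin (n + 1) => (Filter.atTop : Filter ℤ)) i).eventually
      (Filter.eventually_ge_atTop M₀)
  filter_upwards [hev] with V hV
  have hV1 : ∀ i, 1 ≤ V i := fun i => hM1.trans (hV i)
  have hP : 0 < ∏ i, (V i : ℝ) := Finset.prod_pos fun i _ => by
    have := hV1 i
    exact_mod_cast (by omega : 0 < V i)
  rw [count_eq _ V hV1 j hj, Real.dist_eq]
  have hb := hM V hV
  set T := ∑ v ∈ Fintype.piFinset (fun i => Icc (1 : ℤ) (V i)),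
        sgn2 (⌊∑ i, (v i : ℝ) * β i⌋ +
          ∑ i : Fin (n + 1), ∑ j : Fin (n + 1),
            if i < j then ⌊β i + β j⌋ * v i * v j else 0) with hT
  set P := ∏ i, (V i : ℝ) with hPdef
  have e : (P + sgn2 j * T) / 2 / P - 1 / ((2 : ℕ) : ℝ) = sgn2 j * (T / (2 * P)) := by
    push_cast
    field_simp
    ring
  rw [e, abs_mul, sgn2_abs, one_mul, abs_div, abs_of_pos (by positivity : 0 < 2 * P),
    div_lt_iff₀ (by positivity)]
  have : 0 < ε * P := by positivity
  linarith
end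

section
/- Let n ≥ 1, let 1 ≤ k ≤ n, and let β₁,…,βₙ be real numbers such that 1, β₁,…,βₙ are linearly independent over ℚ. Define the n-dimensional integer array S (indexed by integers vᵢ ≥ 1) by S(v) = Σ_{1≤i<j≤k} ⌊βᵢ+βⱼ⌋·vᵢvⱼ + Σ_{k+1≤i<j≤n} ⌊βᵢ+βⱼ⌋·vᵢvⱼ + ⌊Σ_{i=1}^{n} vᵢβᵢ⌋ + Σ_{i=1}^{k} ⌊vᵢ/2⌋ when v₁ + ⋯ + v_k is even, and S(v) = Σ_{1≤i<j≤k} ⌊βᵢ+βⱼ⌋·vᵢvⱼ + Σ_{k+1≤i<j≤n} ⌊βᵢ+βⱼ⌋·vᵢvⱼ + Σ_{i=1}^{k} ⌊vᵢ/2⌋ when v₁ + ⋯ + v_k is odd. Then S is uniformly distributed mod 2. -/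
open Finset

lemma exists_sep (b : ℝ) (hb : Irrational b) (M : ℕ) :
    ∃ δ : ℝ, 0 < δ ∧ ∀ j : ℤ, 0 < j → j < M → ∀ z : ℤ, 2 * δ ≤ |j * b - z| := by
  induction M with
  | zero => exact ⟨1, one_pos, fun j h1 h2 => by push_cast at h2; omega⟩
  | succ M ih =>
    obtain ⟨δ, hδ, h⟩ := ih
    rcases Nat.eq_zero_or_pos M with rfl | hM
    · exact ⟨δ, hδ, fun j h1 h2 => by push_cast at h2; omega⟩
    · have hirr : Irrational ((M : ℝ) * b) := hb.natCast_mul (by omega)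
      have hpos : 0 < |(M : ℝ) * b - round ((M : ℝ) * b)| := by
        rw [abs_pos, sub_ne_zero]
        exact hirr.ne_int _
      refine ⟨min δ (|(M : ℝ) * b - round ((M : ℝ) * b)| / 2), by positivity, ?_⟩
      intro j h1 h2 z
      push_cast at h2
      rcases lt_or_eq_of_le (Int.lt_add_one_iff.mp h2) with h3 | h3
      · have := h j h1 h3 z
        have := min_le_left δ (|(M : ℝ) * b - round ((M : ℝ) * b)| / 2)
        linarith
      · subst h3
        have := min_le_right δ (|(M : ℝ) * b - round ((M : ℝ) * b)| / 2)
        have := round_le ((M : ℝ) * b) z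
        push_cast
        linarith

lemma exists_odd (b : ℝ) (hb : Irrational b) (δ : ℝ) (hδ : 0 < δ) :
    ∃ q z : ℤ, 0 < q ∧ Odd q ∧ |2 * q * b - 2 * z| < δ := by
  have key : ∃ q z : ℤ, Odd q ∧ |2 * q * b - 2 * z| < δ := by
    have hd : Dense (AddSubgroup.closure {2 * b, 1} : Set ℝ) := by
      rw [dense_addSubgroupClosure_pair_iff]
      simpa using hb.natCast_mul (m := 2) (by norm_num)
    obtain ⟨y, hy, hyd⟩ := hd.exists_dist_lt (-b) (half_pos hδ)
    rw [SetLike.mem_coe, AddSubgroup.mem_closure_pair] at hy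
    obtain ⟨p, z, rfl⟩ := hy
    refine ⟨2 * p + 1, -z, ⟨p, rfl⟩, ?_⟩
    rw [Real.dist_eq] at hyd
    simp only [zsmul_eq_mul] at hyd
    rw [abs_lt] at hyd ⊢
    push_cast
    constructor <;> linarith [hyd.1, hyd.2]
  obtain ⟨q, z, hq, h⟩ := key
  rcases lt_trichotomy q 0 with h0 | h0 | h0
  · refine ⟨-q, -z, by omega, hq.neg, ?_⟩
    rw [abs_lt] at h ⊢
    push_cast
    constructor <;> linarith [h.1, h.2]
  · subst h0; simp at hq
  · exact ⟨q, z, h0, hq, h⟩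

lemma floor_stable (x η δ : ℝ) (hη : |η| < δ) (hx : ¬ ∃ z : ℤ, |x - z| < δ) :
    ⌊x + η⌋ = ⌊x⌋ := by
  push Not at hx
  rw [abs_lt] at hη
  have h1 := hx ⌊x⌋
  have h2 := hx (⌊x⌋ + 1)
  have h3 := Int.floor_le x
  have h4 := Int.lt_floor_add_one x
  rw [abs_of_nonneg (by linarith)] at h1
  push_cast at h2
  rw [abs_of_nonpos (by linarith)] at h2
  rw [Int.floor_eq_iff]
  constructor <;> linarith [hη.1, hη.2]

lemma card_sep_s17 (T : Finset ℤ) (V M : ℤ) (hV : 1 ≤ V) (hM : 0 < M) (hT : T ⊆ Icc 1 V)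
    (hs : ∀ a ∈ T, ∀ b ∈ T, a < b → a + M ≤ b) : (#T : ℤ) ≤ V / M + 1 := by
  have : #T ≤ #(Icc 0 (V / M)) := by
    apply Finset.card_le_card_of_injOn (fun t => t / M)
    · intro t ht
      have h := Finset.mem_Icc.mp (hT ht)
      simp only [coe_Icc, Set.mem_Icc]
      exact ⟨Int.ediv_nonneg (by omega) hM.le, Int.ediv_le_ediv hM h.2⟩
    · intro a ha b hb hab
      simp only at hab
      have key : ∀ a ∈ T, ∀ b ∈ T, a / M = b / M → ¬ a < b := by
        intro a ha b hb hab hlt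
        have h1 := hs a ha b hb hlt
        have h2 : (a + M) / M ≤ b / M := Int.ediv_le_ediv hM h1
        rw [Int.add_ediv_of_dvd_right (dvd_refl M), Int.ediv_self hM.ne'] at h2
        omega
      have := key a ha b hb hab
      have := key b hb a ha hab.symm
      omega
  rw [Int.card_Icc] at this
  have h0 : 0 ≤ V / M := Int.ediv_nonneg (by omega) hM.le
  omega

/-- The box of indices. -/
noncomputable def idxBox {n : ℕ} (V : Fin n → ℤ) : Finset (Fin n → ℤ) := Fintype.piFinset fun i => Icc 1 (V i)

lemma mem_box {n : ℕ} {V v : Fin n → ℤ} : v ∈ idxBox V ↔ ∀ i, 1 ≤ v i ∧ v i ≤ V i := by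
  simp [idxBox, Fintype.mem_piFinset]

lemma card_box {n : ℕ} (V : Fin n → ℤ) (hV : ∀ i, 1 ≤ V i) : (#(idxBox V) : ℝ) = ∏ i, (V i : ℝ) := by
  simp only [idxBox, Fintype.card_piFinset, Int.card_Icc, Nat.cast_prod]
  refine Finset.prod_congr rfl fun i _ => ?_
  have : ((V i + 1 - 1).toNat : ℤ) = V i := by have := hV i; omega
  exact_mod_cast congrArg (Int.cast : ℤ → ℝ) this

lemma card_fiber {n : ℕ} (V : Fin n → ℤ) (hV : ∀ i, 1 ≤ V i) (i0 : Fin n)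
    (B : Finset (Fin n → ℤ)) (hB : B ⊆ idxBox V) (K : ℕ)
    (hK : ∀ T : Finset ℤ, T ⊆ Icc 1 (V i0) → (∀ a ∈ T, ∀ b ∈ T, a < b →
      ∃ v ∈ B, ∃ w ∈ B, (∀ i, i ≠ i0 → v i = w i) ∧ v i0 = a ∧ w i0 = b) →
      (∀ a ∈ T, ∃ v ∈ B, v i0 = a) → #T ≤ K) :
    (#B : ℝ) * V i0 ≤ K * ∏ i, (V i : ℝ) := by
  let f : (Fin n → ℤ) → (Fin n → ℤ) := fun v => Function.update v i0 1
  have h1 : #B ≤ K * #(B.image f) := by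
    apply Finset.card_le_mul_card_image
    intro a ha
    have hinj : Set.InjOn (fun v : Fin n → ℤ => v i0) (B.filter fun x => f x = a : Finset _) := by
      intro v hv w hw hvw
      simp only [coe_filter, Set.mem_setOf_eq] at hv hw
      funext i
      by_cases hi : i = i0
      · subst hi; exact hvw
      · have := congrFun (hv.2.trans hw.2.symm) i
        simpa [f, hi] using this
    rw [← Finset.card_image_of_injOn hinj]
    apply hK
    · intro t ht
      simp only [Finset.mem_image, Finset.mem_filter] at ht
      obtain ⟨v, ⟨hv, _⟩, rfl⟩ := ht
      exact Finset.mem_Icc.mpr (mem_box.mp (hB hv) i0)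
    · intro t ht s hs _
      simp only [Finset.mem_image, Finset.mem_filter] at ht hs
      obtain ⟨v, ⟨hv, hva⟩, rfl⟩ := ht
      obtain ⟨w, ⟨hw, hwa⟩, rfl⟩ := hs
      refine ⟨v, hv, w, hw, fun i hi => ?_, rfl, rfl⟩
      have := congrFun (hva.trans hwa.symm) i
      simpa [f, hi] using this
    · intro t ht
      simp only [Finset.mem_image, Finset.mem_filter] at ht
      obtain ⟨v, ⟨hv, hva⟩, rfl⟩ := ht
      exact ⟨v, hv, rfl⟩
  have h2 : B.image f ⊆ idxBox (Function.update V i0 1) := by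
    intro w hw
    obtain ⟨v, hv, rfl⟩ := Finset.mem_image.mp hw
    rw [mem_box]
    intro i
    have := mem_box.mp (hB hv) i
    by_cases hi : i = i0
    · subst hi; simp [f]
    · simpa [f, hi] using this
  have h3 := card_box (Function.update V i0 1) (by
    intro i
    by_cases hi : i = i0
    · subst hi; simp
    · simpa [hi] using hV i)
  have h4 : (∏ i, ((Function.update V i0 1 i : ℤ) : ℝ)) * V i0 = ∏ i, (V i : ℝ) := by
    rw [← Finset.mul_prod_erase univ (fun i => (V i : ℝ)) (Finset.mem_univ i0),
      ← Finset.mul_prod_erase univ _ (Finset.mem_univ i0)]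
    have : ∏ x ∈ univ.erase i0, ((Function.update V i0 1 x : ℤ) : ℝ)
        = ∏ x ∈ univ.erase i0, (V x : ℝ) := by
      refine Finset.prod_congr rfl fun i hi => ?_
      simp [Finset.ne_of_mem_erase hi]
    rw [this]
    simp [mul_comm]
  have h5 : (#B : ℝ) ≤ K * #(idxBox (Function.update V i0 1)) := by
    exact_mod_cast h1.trans (Nat.mul_le_mul_left _ (Finset.card_le_card h2))
  have hp : (0 : ℝ) ≤ V i0 := by exact_mod_cast (by have := hV i0; omega)
  calc (#B : ℝ) * V i0 ≤ K * #(idxBox (Function.update V i0 1)) * V i0 := by gcongr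
    _ = K * ∏ i, (V i : ℝ) := by rw [h3, mul_assoc, h4]

lemma flip_core {n : ℕ} (V : Fin n → ℤ) (hV : ∀ i, 1 ≤ V i) (i0 : Fin n) (S : (Fin n → ℤ) → ℤ)
    (M : ℤ) (hM : 0 < M) (q : ℤ) (hq : 0 < q) (Bad : (Fin n → ℤ) → Prop)
    (hflip : ∀ v, ¬ Bad v → S (v + Pi.single i0 (2 * q)) % 2 ≠ S v % 2)
    (hbad : ∀ v w, Bad v → Bad w → (∀ i, i ≠ i0 → v i = w i) → v i0 < w i0 → v i0 + M ≤ w i0)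
    (j : ℤ) (hj : j = 0 ∨ j = 1) :
    (#((idxBox V).filter fun v => S v % 2 = j) : ℝ) ≤ #((idxBox V).filter fun v => S v % 2 = 1 - j)
      + (1 / M + (1 + 2 * q) / V i0) * ∏ i, (V i : ℝ) := by
  classical
  set A := (idxBox V).filter fun v => S v % 2 = j with hA
  set A' := (idxBox V).filter fun v => S v % 2 = 1 - j with hA'
  set B := (idxBox V).filter Bad with hB
  set C := (idxBox V).filter fun v => V i0 - 2 * q < v i0 with hC
  have hsub : #(A \ (B ∪ C)) ≤ #A' := by
    apply Finset.card_le_card_of_injOn (fun v => v + Pi.single i0 (2 * q))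
    · intro v hv
      simp only [coe_sdiff, Set.mem_sdiff, hA, hB, hC, Finset.mem_coe, Finset.mem_filter,
        Finset.mem_union, not_or, not_and, not_lt, hA'] at hv ⊢
      obtain ⟨⟨hv, hS⟩, hb, hc⟩ := hv
      have hf := hflip v (hb hv)
      refine ⟨?_, ?_⟩
      · rw [mem_box] at hv ⊢
        intro i
        have := hv i
        by_cases hi : i = i0
        · subst hi
          have := hc (mem_box.mpr hv)
          simp only [Pi.add_apply, Pi.single_eq_same]
          omega
        · simpa [hi] using this
      · omega
    · intro v _ w _ h
      exact add_right_cancel h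
  have h1 : #A ≤ #A' + (#B + #C) := by
    have h1 := Finset.le_card_sdiff (B ∪ C) A
    have h2 := Finset.card_union_le B C
    omega
  have hVp : (0 : ℝ) < V i0 := by exact_mod_cast (by have := hV i0; omega)
  have hMp : (0 : ℝ) < M := by exact_mod_cast hM
  have hP : (0 : ℝ) ≤ ∏ i, (V i : ℝ) :=
    Finset.prod_nonneg fun i _ => by exact_mod_cast (by have := hV i; omega)
  have hBc : (#B : ℝ) * V i0 ≤ (V i0 / M + 1).toNat * ∏ i, (V i : ℝ) := by
    apply card_fiber V hV i0 B (Finset.filter_subset _ _)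
    intro T hT h _
    have := card_sep_s17 T (V i0) M (hV i0) hM hT (by
      intro a ha b hb hab
      obtain ⟨v, hv, w, hw, hvw, rfl, rfl⟩ := h a ha b hb hab
      exact hbad v w (Finset.mem_filter.mp hv).2 (Finset.mem_filter.mp hw).2 hvw hab)
    omega
  have hCc : (#C : ℝ) * V i0 ≤ (2 * q).toNat * ∏ i, (V i : ℝ) := by
    apply card_fiber V hV i0 C (Finset.filter_subset _ _)
    intro T hT _ h
    have : T ⊆ Ioc (V i0 - 2 * q) (V i0) := by
      intro t ht
      obtain ⟨v, hv, rfl⟩ := h t ht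
      exact Finset.mem_Ioc.mpr ⟨(Finset.mem_filter.mp hv).2, (Finset.mem_Icc.mp (hT ht)).2⟩
    have := Finset.card_le_card this
    rw [Int.card_Ioc] at this
    omega
  have e1 : (((V i0 / M + 1).toNat : ℕ) : ℝ) ≤ V i0 / M + 1 := by
    have h0 : 0 ≤ V i0 / M := Int.ediv_nonneg (by have := hV i0; omega) hM.le
    have h1 : (((V i0 / M + 1).toNat : ℕ) : ℤ) = V i0 / M + 1 := by omega
    have h2 : (((V i0 / M + 1).toNat : ℕ) : ℝ) = ((V i0 / M : ℤ) : ℝ) + 1 := by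
      exact_mod_cast congrArg (Int.cast : ℤ → ℝ) h1
    rw [h2]
    have h3 : ((V i0 / M : ℤ) : ℝ) ≤ V i0 / M := by
      rw [le_div_iff₀ hMp]
      exact_mod_cast Int.ediv_mul_le _ hM.ne'
    linarith
  have e2 : (((2 * q).toNat : ℕ) : ℝ) = 2 * q := by
    have h1 : (((2 * q).toNat : ℕ) : ℤ) = 2 * q := by omega
    exact_mod_cast congrArg (Int.cast : ℤ → ℝ) h1
  have h1' : (#A : ℝ) ≤ #A' + (#B + #C) := by exact_mod_cast h1
  have h6 : (#B + #C : ℝ) ≤ (1 / M + (1 + 2 * q) / V i0) * ∏ i, (V i : ℝ) := by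
    rw [← mul_le_mul_iff_left₀ hVp]
    calc (#B + #C : ℝ) * V i0 ≤ (V i0 / M + 1) * (∏ i, (V i : ℝ)) + 2 * q * ∏ i, (V i : ℝ) := by
          rw [add_mul]
          rw [e2] at hCc
          have := mul_le_mul_of_nonneg_right e1 hP
          linarith
      _ = _ := by field_simp; ring
  linarith

lemma ud_core {n : ℕ} (i0 : Fin n) (S : (Fin n → ℤ) → ℤ)
    (H : ∀ M : ℕ, 0 < M → ∃ q : ℤ, 0 < q ∧ ∃ Bad : (Fin n → ℤ) → Prop,
      (∀ v, ¬ Bad v → S (v + Pi.single i0 (2 * q)) % 2 ≠ S v % 2) ∧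
      (∀ v w, Bad v → Bad w → (∀ i, i ≠ i0 → v i = w i) → v i0 < w i0 →
        v i0 + (M : ℤ) ≤ w i0)) :
    UniformlyDistributedModM 2 S := by
  intro j hj0 hj2
  have hj : j = 0 ∨ j = 1 := by push_cast at hj2; omega
  rw [Metric.tendsto_nhds]
  intro ε hε
  obtain ⟨M, hM⟩ := exists_nat_gt (1 / ε)
  have hMpos : (0 : ℝ) < M := lt_trans (by positivity) hM
  obtain ⟨q, hq, Bad, hflip, hbad⟩ := H M (by exact_mod_cast hMpos)
  obtain ⟨N, hN⟩ := exists_nat_gt ((1 + 2 * q) / ε)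
  have hev1 : ∀ᶠ V : Fin n → ℤ in Filter.pi fun _ : Fin n => Filter.atTop, ∀ i, 1 ≤ V i := by
    rw [Filter.eventually_all]
    intro i
    exact (Filter.tendsto_eval_pi _ i).eventually (Filter.eventually_ge_atTop 1)
  have hev2 : ∀ᶠ V : Fin n → ℤ in Filter.pi fun _ : Fin n => Filter.atTop, (N : ℤ) ≤ V i0 :=
    (Filter.tendsto_eval_pi _ i0).eventually (Filter.eventually_ge_atTop (N : ℤ))
  filter_upwards [hev1, hev2] with V hV hVN
  have hcard : Nat.card {v : Fin n → ℤ // (∀ i, 1 ≤ v i ∧ v i ≤ V i) ∧ S v % (2 : ℕ) = j}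
      = #((idxBox V).filter fun v => S v % 2 = j) := by
    apply Nat.subtype_card
    intro v
    rw [Finset.mem_filter, mem_box]
    norm_num
  have hP : (0 : ℝ) < ∏ i, (V i : ℝ) :=
    Finset.prod_pos fun i _ => by exact_mod_cast (by have := hV i; omega)
  have f1 := flip_core V hV i0 S M (by exact_mod_cast hMpos) q hq Bad hflip hbad j hj
  have f2 := flip_core V hV i0 S M (by exact_mod_cast hMpos) q hq Bad hflip hbad (1 - j) (by omega)
  rw [sub_sub_cancel] at f2
  have hsum : (#((idxBox V).filter fun v => S v % 2 = j) : ℝ)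
      + #((idxBox V).filter fun v => S v % 2 = 1 - j) = ∏ i, (V i : ℝ) := by
    rw [← card_box V hV, ← Finset.card_filter_add_card_filter_not (s := idxBox V) (fun v => S v % 2 = j)]
    push_cast
    congr 3
    apply Finset.filter_congr
    intro v _
    omega
  rw [hcard]
  have hVp : (0 : ℝ) < V i0 := by exact_mod_cast (by have := hV i0; omega)
  have hVN' : (N : ℝ) ≤ V i0 := by exact_mod_cast hVN
  have g1 : 1 / (M : ℝ) < ε := by
    rw [div_lt_iff₀ hε] at hM
    rw [div_lt_iff₀ hMpos]; linarith
  have g2 : (1 + 2 * q) / (V i0 : ℝ) < ε := by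
    have := lt_of_lt_of_le hN hVN'
    rw [div_lt_iff₀ hε] at this
    rw [div_lt_iff₀ hVp]; linarith
  have g3 : (1 / (M : ℝ) + (1 + 2 * q) / V i0) * ∏ i, (V i : ℝ) < 2 * ε * ∏ i, (V i : ℝ) :=
    mul_lt_mul_of_pos_right (by linarith) hP
  push_cast at f1 f2
  rw [Real.dist_eq, abs_lt]
  push_cast
  constructor
  · rw [neg_lt_sub_iff_lt_add, ← sub_lt_iff_lt_add', lt_div_iff₀ hP]
    linarith
  · rw [sub_lt_iff_lt_add, div_lt_iff₀ hP]
    linarith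

/-- Let `1 ≤ k ≤ n` and let `1, β₁,…,βₙ` be linearly independent over `ℚ`. The integer
array given by
`S(v) = Σ_{i<j≤k} ⌊βᵢ+βⱼ⌋vᵢvⱼ + Σ_{k<i<j} ⌊βᵢ+βⱼ⌋vᵢvⱼ + ⌊Σᵢ vᵢβᵢ⌋ + Σ_{i≤k} ⌊vᵢ/2⌋`
when `v₁+⋯+v_k` is even, and
`S(v) = Σ_{i<j≤k} ⌊βᵢ+βⱼ⌋vᵢvⱼ + Σ_{k<i<j} ⌊βᵢ+βⱼ⌋vᵢvⱼ + Σ_{i≤k} ⌊vᵢ/2⌋`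
when `v₁+⋯+v_k` is odd, is uniformly distributed mod 2. (Indices `i ≤ k` are the first
`k` coordinates; `⌊vᵢ/2⌋` is floor division on `ℤ`.) -/
theorem piecewise_sign_array_ud_mod_two (n : ℕ) (hn : 1 ≤ n) (k : ℕ)
    (hk1 : 1 ≤ k) (hkn : k ≤ n) (β : Fin n → ℝ)
    (hind : ∀ (c₀ : ℤ) (c : Fin n → ℤ),
      (c₀ : ℝ) + ∑ i, (c i : ℝ) * β i = 0 → c₀ = 0 ∧ ∀ i, c i = 0) :
    UniformlyDistributedModM 2
      (fun v : Fin n → ℤ =>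
        (∑ i : Fin n, ∑ j : Fin n,
            if i < j ∧ (j : ℕ) < k then ⌊β i + β j⌋ * v i * v j else 0) +
        (∑ i : Fin n, ∑ j : Fin n,
            if i < j ∧ k ≤ (i : ℕ) then ⌊β i + β j⌋ * v i * v j else 0) +
        (if Even (∑ i ∈ univ.filter fun i : Fin n => (i : ℕ) < k, v i)
          then ⌊∑ i, (v i : ℝ) * β i⌋ else 0) +
        ∑ i ∈ univ.filter fun i : Fin n => (i : ℕ) < k, v i / 2) := by
  set i0 : Fin n := ⟨0, hn⟩ with hi0
  have hi0k : i0 ∈ univ.filter fun i : Fin n => (i : ℕ) < k := by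
    simp [hi0]; omega
  have hb : Irrational (β i0) := by
    rintro ⟨r, hr⟩
    have := (hind (-r.num) (Pi.single i0 (r.den : ℤ)) (by
      rw [Finset.sum_eq_single i0]
      · rw [← hr]
        simp only [Pi.single_eq_same]
        push_cast
        have := Rat.den_mul_eq_num r
        have h2 : ((r.den : ℝ)) * (r : ℝ) = r.num := by exact_mod_cast congrArg (Rat.cast : ℚ → ℝ) this
        rw [h2]; ring
      · intro i _ hi; simp [hi]
      · simp)).2 i0
    simp at this
  apply ud_core i0
  intro M hM
  obtain ⟨δ, hδ, hsep⟩ := exists_sep (β i0) hb M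
  obtain ⟨q, z, hq, hqo, hqz⟩ := exists_odd (β i0) hb δ hδ
  refine ⟨q, hq, fun v => ∃ z : ℤ, |∑ i, (v i : ℝ) * β i - z| < δ, ?_, ?_⟩
  · intro v hv
    set w : Fin n → ℤ := v + Pi.single i0 (2 * q) with hw
    have hwi : ∀ i, w i = v i + 2 * (Pi.single i0 q : Fin n → ℤ) i := by
      intro i
      by_cases hi : i = i0
      · subst hi; simp [hw]
      · simp [hw, hi]
    have hmod : ∀ i, ((w i : ℤ) : ZMod 2) = ((v i : ℤ) : ZMod 2) := by
      intro i
      rw [hwi]; push_cast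
      rw [show (2 : ZMod 2) = 0 from rfl]; ring
    have hx : ∑ i, (w i : ℝ) * β i = ∑ i, (v i : ℝ) * β i + 2 * q * β i0 := by
      have : ∀ i, (w i : ℝ) * β i = (v i : ℝ) * β i + 
          (if i = i0 then 2 * q * β i0 else 0) := by
        intro i
        rw [hwi]
        by_cases hi : i = i0
        · subst hi; simp; ring
        · simp [hi]
      simp_rw [this, Finset.sum_add_distrib]
      simp
    have hfl : ⌊∑ i, (w i : ℝ) * β i⌋ = ⌊∑ i, (v i : ℝ) * β i⌋ + 2 * z := by
      rw [hx, ← floor_stable _ _ δ hqz hv, ← Int.floor_add_intCast]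
      congr 1; push_cast; ring
    have hhalf : ∑ i ∈ univ.filter (fun i : Fin n => (i : ℕ) < k), w i / 2
        = ∑ i ∈ univ.filter (fun i : Fin n => (i : ℕ) < k), v i / 2 + q := by
      have : ∀ i, w i / 2 = v i / 2 + (Pi.single i0 q : Fin n → ℤ) i := by
        intro i; rw [hwi]; omega
      simp_rw [this, Finset.sum_add_distrib]
      have hs : ∑ i ∈ univ.filter (fun i : Fin n => (i : ℕ) < k), (Pi.single i0 q : Fin n → ℤ) i
          = (Pi.single i0 q : Fin n → ℤ) i0 :=
        Finset.sum_eq_single_of_mem i0 hi0k (fun i _ hi => by simp [hi])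
      rw [hs, Pi.single_eq_same]
    have hev : Even (∑ i ∈ univ.filter (fun i : Fin n => (i : ℕ) < k), w i)
        ↔ Even (∑ i ∈ univ.filter (fun i : Fin n => (i : ℕ) < k), v i) := by
      rw [← ZMod.intCast_eq_zero_iff_even, ← ZMod.intCast_eq_zero_iff_even]
      push_cast
      simp_rw [hmod]
    intro hcon
    have hcon2 := (ZMod.intCast_eq_intCast_iff' _ _ 2).mpr hcon
    have hqz2 : ((q : ℤ) : ZMod 2) = 1 := ZMod.intCast_eq_one_iff_odd.mpr hqo
    have h2 : (2 : ZMod 2) = 0 := rfl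
    simp only [hev, hfl, hhalf] at hcon2
    push_cast [apply_ite (Int.cast : ℤ → ZMod 2)] at hcon2
    simp only [hmod, h2, hqz2, zero_mul, add_zero, ← add_assoc] at hcon2
    simp at hcon2
  · rintro v w ⟨a, ha⟩ ⟨b, hb'⟩ hvw hlt
    by_contra hcon
    have hs := hsep (w i0 - v i0) (by omega) (by omega) (b - a)
    have hd : ∑ i, (w i : ℝ) * β i - ∑ i, (v i : ℝ) * β i = (w i0 - v i0) * β i0 := by
      rw [← Finset.sum_sub_distrib, Finset.sum_eq_single i0]
      · ring
      · intro i _ hi; rw [hvw i hi]; ring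
      · simp
    push_cast at hs
    rw [← hd] at hs
    rw [abs_lt] at ha hb'
    have : |∑ i, (w i : ℝ) * β i - ∑ i, (v i : ℝ) * β i - (b - a)| < 2 * δ := by
      rw [abs_lt]; constructor <;> linarith [ha.1, ha.2, hb'.1, hb'.2]
    linarith
end
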